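/- Let d ≥ 4 and let P be a prime centrally symmetric simplicial d-polytope with natural embedding p, and assume additionally that every d vertices of P, no two of which are antipodal, are affinely independent. Let v_0 be a vertex of P, let τ be a missing facet of the link lk(v_0) (a missing face of lk(v_0) of cardinality d−1; note τ ∉ ∂P since P is prime), and let S_1 and S_2 be simplicial complexes on subsets of V(lk(v_0)) such that S_1 ∪ S_2 = lk(v_0) ∪ {τ}, S_1 ∩ S_2 equals the full simplex on τ (all subsets of τ), and each S_i has a vertex not in τ. Then both frameworks (v_0 * S_1, p) and (v_0 * S_2, p) — whose graphs have vertex set V(S_i) ∪ {v_0} and whose edges are the edges of S_i together with all edges from v_0 to vertices of S_i — are infinitesimally rigid in ℝ^d. -/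

import Mathlib

open Finset
open scoped Classical

noncomputable section

/-- A finite graph: a finite vertex set together with a finite set of edges,
where each edge is (intended to be) a 2-element subset of the vertex set. -/
structure FinGraph (ι : Type) where
  verts : Finset ι
  edges : Finset (Finset ι)

/-- Every edge is a 2-element subset of the vertex set. -/
def FinGraph.Good {ι : Type} (G : FinGraph ι) : Prop :=
  ∀ e ∈ G.edges, e ⊆ G.verts ∧ e.card = 2

/-- The standard inner (dot) product on `ℝ^d`. -/
def dotR {d : ℕ} (x y : Fin d → ℝ) : ℝ := ∑ i, x i * y i

/-- An infinitesimal motion of the framework `(G, p)`. -/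
def IsMotion {ι : Type} {d : ℕ} (G : FinGraph ι) (p m : ι → Fin d → ℝ) : Prop :=
  ∀ e ∈ G.edges, ∀ u ∈ e, ∀ v ∈ e, dotR (p u - p v) (m u - m v) = 0

/-- The framework `(G, p)` is infinitesimally rigid in `ℝ^d`: every infinitesimal
motion is the restriction of a motion `x ↦ A x + b` of `ℝ^d` with `A` skew-symmetric. -/
def IsInfRigid {ι : Type} (d : ℕ) (G : FinGraph ι) (p : ι → Fin d → ℝ) : Prop :=
  ∀ m : ι → Fin d → ℝ, IsMotion G p m →
    ∃ (A : Matrix (Fin d) (Fin d) ℝ) (b : Fin d → ℝ),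
      A.transpose = -A ∧ ∀ v ∈ G.verts, m v = A.mulVec (p v) + b

/-- A stress on the framework `(G, p)`. -/
def IsStress {ι : Type} {d : ℕ} (G : FinGraph ι) (p : ι → Fin d → ℝ)
    (ω : Finset ι → ℝ) : Prop :=
  ∀ v ∈ G.verts,
    (∑ e ∈ G.edges.filter (fun e => v ∈ e), ∑ u ∈ e.erase v, ω e • (p v - p u)) = 0

/-- A centrally symmetric framework with free involution `ν` satisfying `p (ν v) = -(p v)`. -/
def IsCSFramework {ι : Type} {d : ℕ} (G : FinGraph ι) (p : ι → Fin d → ℝ) (ν : ι → ι) : Prop :=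
  (∀ v ∈ G.verts, ν (ν v) = v) ∧
  (∀ v ∈ G.verts, ν v ∈ G.verts) ∧
  (∀ v ∈ G.verts, ν v ≠ v) ∧
  (∀ e ∈ G.edges, e.image ν ∈ G.edges) ∧
  (∀ e ∈ G.edges, e.image ν ≠ e) ∧
  (∀ v ∈ G.verts, p (ν v) = -(p v))

/-- The convex body spanned by a finite point set. -/
def polyBody {d : ℕ} (V : Finset (Fin d → ℝ)) : Set (Fin d → ℝ) :=
  convexHull ℝ (V : Set (Fin d → ℝ))

/-- `(f, c)` is a supporting functional for `conv V` exposing the face `F`. -/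
def IsSupport {d : ℕ} (V : Finset (Fin d → ℝ)) (f : (Fin d → ℝ) →ₗ[ℝ] ℝ) (c : ℝ)
    (F : Set (Fin d → ℝ)) : Prop :=
  (∀ y ∈ polyBody V, f y ≤ c) ∧ F = {y ∈ polyBody V | f y = c}

/-- A proper face of the polytope `conv V`. -/
def IsProperFace {d : ℕ} (V : Finset (Fin d → ℝ)) (F : Set (Fin d → ℝ)) : Prop :=
  (∃ f c, IsSupport V f c F) ∧ F ≠ polyBody V

/-- A simplicial `d`-polytope in `ℝ^d`, recorded by its vertex set `V`: the polytope is
`conv V`, it is `d`-dimensional, every element of `V` is a vertex, and every proper face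
is a simplex (the convex hull of its affinely independent vertex set). -/
structure SPolytope (d : ℕ) where
  V : Finset (Fin d → ℝ)
  span_top : affineSpan ℝ (V : Set (Fin d → ℝ)) = ⊤
  extreme : ∀ v ∈ V, v ∉ convexHull ℝ ((V.erase v : Finset (Fin d → ℝ)) : Set (Fin d → ℝ))
  simplicial : ∀ F : Set (Fin d → ℝ), IsProperFace V F →
    AffineIndependent ℝ
      (fun x : {y : Fin d → ℝ // y ∈ (V : Set (Fin d → ℝ)) ∩ F} => (x : Fin d → ℝ)) ∧
    F = convexHull ℝ ((V : Set (Fin d → ℝ)) ∩ F)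

/-- `s` is a face of the boundary complex `∂P`. -/
def BFace {d : ℕ} (P : SPolytope d) (s : Finset (Fin d → ℝ)) : Prop :=
  s ⊆ P.V ∧ ∃ F : Set (Fin d → ℝ), IsProperFace P.V F ∧ (s : Set (Fin d → ℝ)) ⊆ F

/-- The number of vertices of `∂P`. -/
def f0 {d : ℕ} (P : SPolytope d) : ℕ := P.V.card

/-- The edges of `∂P`. -/
def edgeFinset {d : ℕ} (P : SPolytope d) : Finset (Finset (Fin d → ℝ)) :=
  P.V.powerset.filter fun e => e.card = 2 ∧ BFace P e

/-- The number of edges of `∂P`. -/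
def f1 {d : ℕ} (P : SPolytope d) : ℕ := (edgeFinset P).card

/-- `g₂(P) = f₁ - d f₀ + C(d+1, 2)`. -/
def g2 {d : ℕ} (P : SPolytope d) : ℤ :=
  (f1 P : ℤ) - (d : ℤ) * (f0 P : ℤ) + ((d + 1).choose 2 : ℤ)

/-- `P` is centrally symmetric. -/
def IsCS {d : ℕ} (P : SPolytope d) : Prop := ∀ v ∈ P.V, -v ∈ P.V

/-- A missing face of `∂P`. -/
def IsMissingFace {d : ℕ} (P : SPolytope d) (σ : Finset (Fin d → ℝ)) : Prop :=
  σ ⊆ P.V ∧ ¬ BFace P σ ∧ ∀ τ ⊂ σ, BFace P τ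

/-- `P` is prime: `∂P` has no missing facet, i.e. no missing face of cardinality `d`. -/
def IsPrimePoly {d : ℕ} (P : SPolytope d) : Prop :=
  ¬ ∃ σ : Finset (Fin d → ℝ), IsMissingFace P σ ∧ σ.card = d

/-- The graph (1-skeleton) of `∂P` as a framework graph. -/
def fullGraph {d : ℕ} (P : SPolytope d) : FinGraph (Fin d → ℝ) :=
  ⟨P.V, edgeFinset P⟩

/-- The graph (1-skeleton) of the star of the face `τ` in `∂P`. -/
def starGraph {d : ℕ} (P : SPolytope d) (τ : Finset (Fin d → ℝ)) : FinGraph (Fin d → ℝ) :=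
  ⟨P.V.filter fun v => BFace P (insert v τ),
   P.V.powerset.filter fun e => e.card = 2 ∧ BFace P (e ∪ τ)⟩

/-- Adjacency in the graph of `∂P`. -/
def Adj {d : ℕ} (P : SPolytope d) (u v : Fin d → ℝ) : Prop :=
  u ≠ v ∧ BFace P {u, v}

/-- `σ` is a face of the link of the face `τ` in `∂P`. -/
def LinkFace {d : ℕ} (P : SPolytope d) (τ σ : Finset (Fin d → ℝ)) : Prop :=
  Disjoint σ τ ∧ BFace P (σ ∪ τ)

/-- `P` is a `d`-dimensional cross-polytope: its vertex set is `{±b₁, …, ±b_d}`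
for some basis `b₁, …, b_d` of `ℝ^d`. -/
def IsCrossPolytope {d : ℕ} (P : SPolytope d) : Prop :=
  ∃ b : Fin d → (Fin d → ℝ), LinearIndependent ℝ b ∧
    (P.V : Set (Fin d → ℝ)) = Set.range b ∪ Set.range (fun i => -(b i))

/-- A facet of `P`: a proper face with `d` vertices. -/
def IsFacet {d : ℕ} (P : SPolytope d) (F : Set (Fin d → ℝ)) : Prop :=
  IsProperFace P.V F ∧ ((P.V : Set (Fin d → ℝ)) ∩ F).ncard = d

/-- `x` lies beyond exactly one facet of `P`: it is strictly separated from `P` by the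
affine hull of one facet `F`, and not separated from `P` by the affine hull of any
other facet. -/
def BeyondExactlyOne {d : ℕ} (P : SPolytope d) (x : Fin d → ℝ) : Prop :=
  ∃ F : Set (Fin d → ℝ), IsFacet P F ∧
    (∀ f c, IsSupport P.V f c F → c < f x) ∧
    (∀ F' : Set (Fin d → ℝ), IsFacet P F' → F' ≠ F →
      ∀ f c, IsSupport P.V f c F' → f x < c)

/-- `P` is obtained from a `d`-dimensional cross-polytope by symmetric stacking: there is
a sequence of cs simplicial `d`-polytopes starting at a cross-polytope and ending at `P`,
each obtained from the previous one as `conv (P_k ∪ {v, -v})` for a point `v` lying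
beyond exactly one facet of `P_k`. -/
def SymmetricStackingFrom {d : ℕ} (P : SPolytope d) : Prop :=
  ∃ (m : ℕ) (Q : Fin (m + 1) → SPolytope d),
    (∀ k, IsCS (Q k)) ∧
    IsCrossPolytope (Q 0) ∧
    Q (Fin.last m) = P ∧
    ∀ k : Fin m, ∃ v : Fin d → ℝ,
      BeyondExactlyOne (Q (Fin.castSucc k)) v ∧
      polyBody (Q (Fin.succ k)).V =
        convexHull ℝ (polyBody (Q (Fin.castSucc k)).V ∪ {v, -v})

/-- `P` is a stacked `d`-polytope: obtained from a `d`-simplex by repeatedly adding a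
point beyond exactly one facet. -/
def IsStacked {d : ℕ} (P : SPolytope d) : Prop :=
  ∃ (m : ℕ) (R : Fin (m + 1) → SPolytope d),
    (R 0).V.card = d + 1 ∧
    R (Fin.last m) = P ∧
    ∀ k : Fin m, ∃ v : Fin d → ℝ,
      BeyondExactlyOne (R (Fin.castSucc k)) v ∧
      polyBody (R (Fin.succ k)).V =
        convexHull ℝ (polyBody (R (Fin.castSucc k)).V ∪ {v})

/-- Every `d` vertices of `P`, no two of which are antipodal, are affinely independent. -/
def GenPos {d : ℕ} (P : SPolytope d) : Prop :=
  ∀ S : Finset (Fin d → ℝ), S ⊆ P.V → S.card = d →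
    (∀ x ∈ S, ∀ y ∈ S, x ≠ -y) →
    AffineIndependent ℝ (fun s : {x : Fin d → ℝ // x ∈ S} => (s : Fin d → ℝ))

/-- The graph of the cone `v₀ * S` over a simplicial complex `S` (a set of finsets):
the vertices of `S` together with `v₀`, and the edges of `S` together with all edges
from `v₀` to vertices of `S`. -/
def coneGraph {d : ℕ} (P : SPolytope d) (v0 : Fin d → ℝ)
    (S : Set (Finset (Fin d → ℝ))) : FinGraph (Fin d → ℝ) :=
  ⟨insert v0 (P.V.filter fun u => ({u} : Finset (Fin d → ℝ)) ∈ S),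
   (P.V.powerset.filter fun e => e.card = 2 ∧ e ∈ S) ∪
     (P.V.filter fun u => ({u} : Finset (Fin d → ℝ)) ∈ S).image
       fun u => ({v0, u} : Finset (Fin d → ℝ))⟩

namespace RigAux

/-- valid functional -/
def Valid {d : ℕ} (V : Finset (Fin d → ℝ)) (y : (Fin d → ℝ) →ₗ[ℝ] ℝ) : Prop :=
  ∀ v ∈ V, y v ≤ 1

def Fac {d : ℕ} (V : Finset (Fin d → ℝ)) (s : Finset (Fin d → ℝ)) : Prop :=
  s ⊆ V ∧ ∃ y : (Fin d → ℝ) →ₗ[ℝ] ℝ, Valid V y ∧ ∀ v ∈ s, y v = 1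

structure Sys {d : ℕ} (V : Finset (Fin d → ℝ)) : Prop where
  neg : ∀ v ∈ V, -v ∈ V
  span : ∀ z : (Fin d → ℝ) →ₗ[ℝ] ℝ, (∀ v ∈ V, z v = 0) → z = 0
  indep : ∀ y : (Fin d → ℝ) →ₗ[ℝ] ℝ, Valid V y →
    LinearIndepOn ℝ id ((V.filter fun v => y v = 1 : Finset (Fin d → ℝ)) : Set (Fin d → ℝ))

variable {d : ℕ} {V : Finset (Fin d → ℝ)}

lemma Fac.mono {s t : Finset (Fin d → ℝ)} (h : Fac V t) (hst : s ⊆ t) : Fac V s := by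
  obtain ⟨h1, y, hy, h2⟩ := h
  exact ⟨hst.trans h1, y, hy, fun v hv => h2 v (hst hv)⟩

lemma Fac.indep (hS : Sys V) {s : Finset (Fin d → ℝ)} (h : Fac V s) :
    LinearIndepOn ℝ id (s : Set (Fin d → ℝ)) := by
  obtain ⟨h1, y, hy, h2⟩ := h
  refine (hS.indep y hy).mono ?_
  intro v hv
  simp only [Finset.coe_filter, Set.mem_ofPred_eq]
  exact ⟨h1 hv, h2 v hv⟩

lemma exists_functional {s : Finset (Fin d → ℝ)}
    (h : LinearIndepOn ℝ id (s : Set (Fin d → ℝ))) (k : (Fin d → ℝ) → ℝ) :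
    ∃ θ : (Fin d → ℝ) →ₗ[ℝ] ℝ, ∀ v ∈ s, θ v = k v := by
  let b := Module.Basis.extend h
  refine ⟨b.constr ℝ (fun i => k i), fun v hv => ?_⟩
  have hv' : v ∈ h.extend (Set.subset_univ _) := h.subset_extend _ hv
  have : b ⟨v, hv'⟩ = v := Module.Basis.extend_apply_self h ⟨v, hv'⟩
  conv_lhs => rw [← this]
  rw [Module.Basis.constr_basis]

lemma coeff_eq_zero {s : Finset (Fin d → ℝ)}
    (h : LinearIndepOn ℝ id (s : Set (Fin d → ℝ))) (c : (Fin d → ℝ) → ℝ)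
    (h0 : ∑ v ∈ s, c v • v = 0) : ∀ v ∈ s, c v = 0 := by
  intro v hv
  obtain ⟨θ, hθ⟩ := exists_functional h (fun w => if w = v then 1 else 0)
  have := congrArg θ h0
  rw [map_sum, map_zero] at this
  rw [Finset.sum_congr rfl (g := fun w => if w = v then c v else 0)] at this
  · simpa [hv] using this
  · intro w hw
    rw [map_smul, hθ w hw]
    split_ifs with h <;> simp [h]

lemma card_le_of_indep {s : Finset (Fin d → ℝ)}
    (h : LinearIndepOn ℝ id (s : Set (Fin d → ℝ))) : s.card ≤ d := by
  have := LinearIndependent.fintype_card_le_finrank (R := ℝ) h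
  simpa using this

lemma span_of_card {s : Finset (Fin d → ℝ)}
    (h : LinearIndepOn ℝ id (s : Set (Fin d → ℝ))) (hc : s.card = d) :
    Submodule.span ℝ (s : Set (Fin d → ℝ)) = ⊤ := by
  apply Submodule.eq_top_of_finrank_eq
  have := finrank_span_finset_eq_card (R := ℝ) (s := s) h
  rw [this, hc]; simp

lemma expand {s : Finset (Fin d → ℝ)}
    (h : LinearIndepOn ℝ id (s : Set (Fin d → ℝ))) (hc : s.card = d) (x : Fin d → ℝ) :
    ∃ c : (Fin d → ℝ) → ℝ, x = ∑ v ∈ s, c v • v := by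
  have : x ∈ Submodule.span ℝ (s : Set (Fin d → ℝ)) := by rw [span_of_card h hc]; trivial
  rw [Submodule.mem_span_finset] at this
  obtain ⟨c, -, hc⟩ := this
  exact ⟨c, hc.symm⟩

lemma functional_ext {s : Finset (Fin d → ℝ)}
    (h : LinearIndepOn ℝ id (s : Set (Fin d → ℝ))) (hc : s.card = d)
    {f g : (Fin d → ℝ) →ₗ[ℝ] ℝ} (hfg : ∀ v ∈ s, f v = g v) : f = g := by
  exact LinearMap.ext_on (span_of_card h hc) hfg

/-- small set has annihilating functional -/
lemma exists_annih {s : Finset (Fin d → ℝ)} (hc : s.card < d) :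
    ∃ z : (Fin d → ℝ) →ₗ[ℝ] ℝ, z ≠ 0 ∧ ∀ v ∈ s, z v = 0 := by
  have h1 : Submodule.span ℝ (s : Set (Fin d → ℝ)) < ⊤ := by
    rw [lt_top_iff_ne_top]
    intro h
    have h2 := finrank_span_finset_le_card (R := ℝ) s
    rw [Set.finrank, h] at h2
    simp at h2
    omega
  obtain ⟨f, hf, hf2⟩ := Submodule.exists_le_ker_of_lt_top _ h1
  exact ⟨f, hf, fun v hv => hf2 (Submodule.subset_span hv)⟩

/-- pivoting -/
lemma pivot (hS : Sys V) {y z : (Fin d → ℝ) →ₗ[ℝ] ℝ} (hy : Valid V y) (hz : z ≠ 0)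
    (ht : ∀ v ∈ V, y v = 1 → z v ≤ 0) :
    ∃ s : ℝ, 0 < s ∧ Valid V (y + s • z) ∧ ∃ w ∈ V, 0 < z w ∧ (y + s • z) w = 1 := by
  have hne : (V.filter fun v => 0 < z v).Nonempty := by
    by_contra hcon
    rw [Finset.not_nonempty_iff_eq_empty, Finset.filter_eq_empty_iff] at hcon
    apply hz
    apply hS.span
    intro v hv
    have h1 := hcon hv
    have h2 := hcon (hS.neg v hv)
    simp at h1 h2
    linarith
  obtain ⟨w, hw, hmin⟩ := Finset.exists_min_image _ (fun v => (1 - y v) / z v) hne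
  rw [Finset.mem_filter] at hw
  have hyw : y w < 1 := by
    rcases lt_or_eq_of_le (hy w hw.1) with h | h
    · exact h
    · have := ht w hw.1 h; linarith [hw.2]
  have hs : 0 < (1 - y w) / z w := div_pos (by linarith) hw.2
  refine ⟨(1 - y w) / z w, hs, ?_, w, hw.1, hw.2, ?_⟩
  · intro v hv
    simp only [LinearMap.add_apply, LinearMap.smul_apply, smul_eq_mul]
    by_cases hzv : 0 < z v
    · have := hmin v (by simp [hv, hzv])
      rw [le_div_iff₀ hzv] at this
      linarith
    · have := hy v hv
      have : (1 - y w) / z w * z v ≤ 0 := mul_nonpos_of_nonneg_of_nonpos hs.le (not_lt.mp hzv)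
      linarith
  · simp only [LinearMap.add_apply, LinearMap.smul_apply, smul_eq_mul]
    have := hw.2.ne'
    field_simp
    ring

lemma Fac.exists_facet (hS : Sys V) {s : Finset (Fin d → ℝ)} (h : Fac V s) :
    ∃ F, s ⊆ F ∧ F.card = d ∧ Fac V F := by
  have hfin : (V.powerset.filter fun F => s ⊆ F ∧ Fac V F).Nonempty :=
    ⟨s, by simp [h, h.1]⟩
  obtain ⟨F, hF, hmax⟩ := Finset.exists_max_image _ Finset.card hfin
  simp only [Finset.mem_filter, Finset.mem_powerset] at hF hmax
  refine ⟨F, hF.2.1, ?_, hF.2.2⟩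
  by_contra hcard
  have hlt : F.card < d := lt_of_le_of_ne (card_le_of_indep (hF.2.2.indep hS)) hcard
  obtain ⟨hFV, y, hy, hyF⟩ := hF.2.2
  set T := V.filter fun v => y v = 1 with hT
  have hFT : F ⊆ T := fun v hv => by simp [hT, hFV hv, hyF v hv]
  have hTfac : Fac V T := ⟨Finset.filter_subset _ _, y, hy, fun v hv => by
    simp [hT] at hv; exact hv.2⟩
  have h1 := hmax T ⟨hTfac.1, hF.2.1.trans hFT, hTfac⟩
  obtain ⟨z, hz0, hz⟩ := exists_annih (s := T) (by omega)
  obtain ⟨t, ht, hval, w, hwV, hzw, hw1⟩ := pivot hS hy hz0 (fun v hv hv1 =>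
    (hz v (by simp [hT, hv, hv1])).le)
  have hfac : Fac V (insert w T) := by
    refine ⟨Finset.insert_subset hwV hTfac.1, y + t • z, hval, fun v hv => ?_⟩
    rcases Finset.mem_insert.mp hv with rfl | hv
    · exact hw1
    · have h3 := hz v hv
      have : y v = 1 := by simp [hT] at hv; exact hv.2
      simp [h3, this]
  have hwT : w ∉ T := fun hwT => by rw [hz w hwT] at hzw; exact lt_irrefl _ hzw
  have h2 := hmax _ ⟨hfac.1, (hF.2.1.trans hFT).trans (Finset.subset_insert _ _), hfac⟩
  rw [Finset.card_insert_of_notMem hwT] at h2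
  have := Finset.card_le_card hFT
  omega

lemma Fac.tight (hS : Sys V) {F : Finset (Fin d → ℝ)} (hc : F.card = d)
    (hFV : F ⊆ V) {y : (Fin d → ℝ) →ₗ[ℝ] ℝ} (hy : Valid V y)
    (hyF : ∀ v ∈ F, y v = 1) : ∀ v ∈ V, y v = 1 → v ∈ F := by
  have h1 := card_le_of_indep (hS.indep y hy)
  have hFT : F ⊆ V.filter fun v => y v = 1 := fun v hv => by simp [hFV hv, hyF v hv]
  have := Finset.eq_of_subset_of_card_le hFT (by omega)
  intro v hv hv1
  rw [this]; simp [hv, hv1]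

/-- pivoting a facet -/
lemma facet_pivot (hS : Sys V) {F : Finset (Fin d → ℝ)} (hc : F.card = d) (hFV : F ⊆ V)
    {y : (Fin d → ℝ) →ₗ[ℝ] ℝ} (hy : Valid V y)
    (hyF : ∀ v ∈ F, y v = 1) {f : Fin d → ℝ} (hf : f ∈ F)
    {z : (Fin d → ℝ) →ₗ[ℝ] ℝ} (hzf : z f = -1) (hz : ∀ v ∈ F.erase f, z v = 0) :
    ∃ w ∈ V, w ∉ F ∧ 0 < z w ∧ ∃ s : ℝ, 0 < s ∧ Valid V (y + s • z) ∧
      ∀ v ∈ insert w (F.erase f), (y + s • z) v = 1 := by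
  have hz0 : z ≠ 0 := by rintro rfl; simp at hzf
  have htight := Fac.tight hS hc hFV hy hyF
  have hzF : ∀ v ∈ F, z v ≤ 0 := by
    intro v hv
    by_cases h : v = f
    · subst h; linarith
    · exact (hz v (by simp [h, hv])).le
  obtain ⟨s, hs, hval, w, hwV, hzw, hw1⟩ := pivot hS hy hz0 (fun v hv hv1 =>
    hzF v (htight v hv hv1))
  refine ⟨w, hwV, fun h => by linarith [hzF w h], hzw, s, hs, hval, fun v hv => ?_⟩
  rcases Finset.mem_insert.mp hv with rfl | hv
  · exact hw1
  · simp [hz v hv, hyF v (Finset.mem_of_mem_erase hv)]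

/-- uniqueness of carriers -/
lemma carrier_subset (hS : Sys V) {S T : Finset (Fin d → ℝ)} (hSf : Fac V S) (hTf : Fac V T)
    (a b : (Fin d → ℝ) → ℝ) (ha : ∀ v ∈ S, 0 < a v) (hb : ∀ v ∈ T, 0 ≤ b v)
    (hab : ∑ v ∈ S, a v • v = ∑ v ∈ T, b v • v) : S ⊆ T := by
  obtain ⟨hSV, y, hy, hyS⟩ := hSf
  obtain ⟨hTV, x, hx, hxT⟩ := hTf
  have e1 : ∑ v ∈ S, a v = ∑ v ∈ T, b v * y v := by
    have := congrArg y hab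
    simp only [map_sum, map_smul, smul_eq_mul] at this
    rw [← this]
    exact Finset.sum_congr rfl fun v hv => by rw [hyS v hv, mul_one]
  have e2 : ∑ v ∈ S, a v * x v = ∑ v ∈ T, b v := by
    have := congrArg x hab
    simp only [map_sum, map_smul, smul_eq_mul] at this
    rw [this]
    exact Finset.sum_congr rfl fun v hv => by rw [hxT v hv, mul_one]
  have i1 : ∑ v ∈ T, b v * y v ≤ ∑ v ∈ T, b v :=
    Finset.sum_le_sum fun v hv => by nlinarith [hb v hv, hy v (hTV hv)]
  have i2 : ∀ v ∈ S, a v * x v ≤ a v := fun v hv => by nlinarith [ha v hv, hx v (hSV hv)]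
  have e3 : ∑ v ∈ S, a v * x v = ∑ v ∈ S, a v :=
    le_antisymm (Finset.sum_le_sum i2) (by linarith)
  have e4 := (Finset.sum_eq_sum_iff_of_le i2).mp e3
  have hxS : ∀ v ∈ S, x v = 1 := fun v hv => by
    have h1 := e4 v hv
    have h2 := ha v hv
    exact mul_left_cancel₀ h2.ne' (by linarith)
  have hU : LinearIndepOn ℝ id ((S ∪ T : Finset (Fin d → ℝ)) : Set (Fin d → ℝ)) := by
    refine (hS.indep x hx).mono ?_
    intro v hv
    simp only [Finset.coe_filter, Set.mem_ofPred_eq]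
    rcases Finset.mem_union.mp (Finset.mem_coe.mp hv) with h | h
    · exact ⟨hSV h, hxS v h⟩
    · exact ⟨hTV h, hxT v h⟩
  intro v hv
  by_contra hvT
  have := coeff_eq_zero hU (fun w => (if w ∈ S then a w else 0) - (if w ∈ T then b w else 0)) (by
    simp only [sub_smul, Finset.sum_sub_distrib, ite_smul, zero_smul]
    rw [Finset.sum_ite_mem, Finset.sum_ite_mem, Finset.union_inter_cancel_left,
      Finset.union_inter_cancel_right, hab, sub_self]) v (Finset.mem_union_left _ hv)
  simp [hv, hvT] at this
  linarith [ha v hv]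

/-- two facets through a ridge -/
lemma ridge_unique (hS : Sys V) {F : Finset (Fin d → ℝ)} (hc : F.card = d) (hFV : F ⊆ V)
    {y : (Fin d → ℝ) →ₗ[ℝ] ℝ} (hy : Valid V y)
    (hyF : ∀ v ∈ F, y v = 1) {f : Fin d → ℝ} (hf : f ∈ F)
    {z : (Fin d → ℝ) →ₗ[ℝ] ℝ} (hzf : z f = -1) (hz : ∀ v ∈ F.erase f, z v = 0)
    {w : Fin d → ℝ} (hw : w ∈ V) (hzw : 0 < z w) {s : ℝ}
    (hval : Valid V (y + s • z)) (hw1 : (y + s • z) w = 1)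
    {w' : Fin d → ℝ} (hw' : Fac V (insert w' (F.erase f))) (hw'R : w' ∉ F.erase f) :
    w' = f ∨ w' = w := by
  have hindF : LinearIndepOn ℝ id (F : Set (Fin d → ℝ)) := Fac.indep hS ⟨hFV, y, hy, hyF⟩
  have hwR : w ∉ F.erase f := fun h => by rw [hz w h] at hzw; exact lt_irrefl _ hzw
  obtain ⟨hsub, y', hy', hyF'⟩ := hw'
  have heq : y' = y + (1 - y' f) • z := by
    apply functional_ext hindF hc
    intro v hv
    by_cases h : v = f
    · subst h; simp [hzf, hyF v hf]
    · have hvE : v ∈ F.erase f := by simp [h, hv]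
      simp [hz v hvE, hyF v hv, hyF' v (Finset.mem_insert_of_mem hvE)]
  set s' := 1 - y' f with hs'
  have hw'V : w' ∈ V := hsub (Finset.mem_insert_self _ _)
  have hw'1 : y w' + s' * z w' = 1 := by
    have := hyF' w' (Finset.mem_insert_self _ _)
    rw [heq] at this; simpa using this
  have hw11 : y w + s * z w = 1 := by simpa using hw1
  have hv1 : y w + s' * z w ≤ 1 := by
    have := hy' w hw; rw [heq] at this; simpa using this
  have hv2 : y w' + s * z w' ≤ 1 := by
    have := hval w' hw'V; simpa using this
  have hs'0 : 0 ≤ s' := by have := hy' f (hFV hf); linarith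
  have hcR : (F.erase f).card + 1 = d := by rw [Finset.card_erase_add_one hf, hc]
  rcases eq_or_lt_of_le hs'0 with h0 | h0
  · left
    rw [← h0] at hw'1
    have : w' ∈ F := Fac.tight hS hc hFV hy hyF w' hw'V (by linarith)
    by_contra hne
    exact hw'R (by simp [hne, this])
  · right
    have hle : s' ≤ s := by nlinarith
    have hzw' : 0 < z w' := by
      by_contra hcon
      have h1 := hy w' hw'V
      have h2 : z w' = 0 := by nlinarith
      have h3 : w' ∈ F := Fac.tight hS hc hFV hy hyF w' hw'V (by rw [h2] at hw'1; linarith)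
      have h4 : w' = f := by
        by_contra hne
        exact hw'R (by simp [hne, h3])
      rw [h4, hzf] at h2; linarith
    have hge : s ≤ s' := by nlinarith
    have hss : s' = s := le_antisymm hle hge
    have hc2 : (insert w (F.erase f)).card = d := by rw [Finset.card_insert_of_notMem hwR, hcR]
    have := Fac.tight hS (y := y + s • z) hc2
      (Finset.insert_subset hw ((Finset.erase_subset _ _).trans hFV)) hval
      (fun v hv => by
        rcases Finset.mem_insert.mp hv with rfl | hv
        · exact hw1
        · simp [hz v hv, hyF v (Finset.mem_of_mem_erase hv)]) w' hw'V
      (by rw [← hss]; simpa using hw'1)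
    rcases Finset.mem_insert.mp this with h | h
    · exact h
    · exact absurd h hw'R

end RigAux

namespace RigAux
variable {d : ℕ} {V : Finset (Fin d → ℝ)}

def absDet (F : Finset (Fin d → ℝ)) : ℝ :=
  if h : F.card = d then |Matrix.det (fun i => (((F.equivFinOfCardEq h).symm i : F) : Fin d → ℝ))|
  else 0

lemma absDet_eq {F : Finset (Fin d → ℝ)} (h : F.card = d) (e : Fin d ≃ F) :
    absDet F = |Matrix.det (fun i => ((e i : F) : Fin d → ℝ))| := by
  rw [absDet, dif_pos h]
  set e' := (F.equivFinOfCardEq h).symm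
  have h1 : (fun i => ((e i : F) : Fin d → ℝ)) =
      Matrix.submatrix (Matrix.of fun i => ((e' i : F) : Fin d → ℝ)) (e.trans e'.symm) id := by
    ext i j
    simp [Matrix.submatrix]
  have h2 := Matrix.det_permute (e.trans e'.symm) (Matrix.of fun i => ((e' i : F) : Fin d → ℝ))
  rw [h1, h2, abs_mul]
  rcases Int.units_eq_one_or (Equiv.Perm.sign (e.trans e'.symm)) with h3 | h3 <;> rw [h3] <;> simp <;> rfl

lemma absDet_pos {F : Finset (Fin d → ℝ)} (h : F.card = d)
    (hi : LinearIndepOn ℝ id (F : Set (Fin d → ℝ))) : 0 < absDet F := by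
  rw [absDet, dif_pos h, abs_pos]
  have h1 : LinearIndependent ℝ (fun x : F => (x : Fin d → ℝ)) := hi
  have h2 := h1.comp _ (F.equivFinOfCardEq h).symm.injective
  have h3 := Matrix.linearIndependent_rows_iff_isUnit (K := ℝ)
    (A := Matrix.of fun i => (((F.equivFinOfCardEq h).symm i : F) : Fin d → ℝ))
  have h4 := h3.mp h2
  rw [Matrix.isUnit_iff_isUnit_det] at h4
  exact h4.ne_zero

lemma absDet_swap {R : Finset (Fin d → ℝ)} (hR : R.card + 1 = d) {f w : Fin d → ℝ}
    (hf : f ∉ R) (hw : w ∉ R) {t : ℝ}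
    (ht : w + t • f ∈ Submodule.span ℝ (R : Set (Fin d → ℝ))) :
    absDet (insert w R) = |t| * absDet (insert f R) := by
  have hcf : (insert f R).card = d := by rw [Finset.card_insert_of_notMem hf, hR]
  have hcw : (insert w R).card = d := by rw [Finset.card_insert_of_notMem hw, hR]
  let e : Fin d ≃ (insert f R : Finset _) := ((insert f R).equivFinOfCardEq hcf).symm
  let i0 := e.symm ⟨f, Finset.mem_insert_self _ _⟩
  have hei0 : e i0 = ⟨f, Finset.mem_insert_self _ _⟩ := e.apply_symm_apply _
  have heR : ∀ i, i ≠ i0 → (e i : Fin d → ℝ) ∈ R := by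
    intro i hi
    rcases Finset.mem_insert.mp (e i).2 with h | h
    · exact absurd (e.injective (Subtype.ext (by rw [hei0, h]))) hi
    · exact h
  let g : Fin d → (insert w R : Finset _) := fun i =>
    if h : i = i0 then ⟨w, Finset.mem_insert_self _ _⟩
    else ⟨e i, Finset.mem_insert_of_mem (heR i h)⟩
  have hg : Function.Injective g := by
    intro i j hij
    have hij' := congrArg (Subtype.val) hij
    by_cases hi : i = i0 <;> by_cases hj : j = i0
    · rw [hi, hj]
    · simp only [g, hi, hj, dif_pos, dif_neg, not_false_eq_true] at hij'
      exact absurd (hij' ▸ heR j hj) hw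
    · simp only [g, hi, hj, dif_pos, dif_neg, not_false_eq_true] at hij'
      exact absurd (hij' ▸ heR i hi) hw
    · simp only [g, hi, hj, dif_neg, not_false_eq_true] at hij'
      exact e.injective (Subtype.ext hij')
  have hgb : Function.Bijective g := by
    rw [Fintype.bijective_iff_injective_and_card]
    exact ⟨hg, by simp [hcw]⟩
  rw [absDet_eq hcw (Equiv.ofBijective g hgb), absDet_eq hcf e]
  have hM : (fun i => ((Equiv.ofBijective g hgb i : (insert w R : Finset _)) : Fin d → ℝ)) =
      Matrix.updateRow (fun i => ((e i : (insert f R : Finset _)) : Fin d → ℝ)) i0 w := by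
    funext i
    by_cases hi : i = i0
    · subst hi; simp [g]; exact (Matrix.updateRow_self ..).symm
    · simp [g, hi]; exact (Function.update_of_ne hi w (fun i => ((e i : (insert f R : Finset _)) : Fin d → ℝ))).symm
  rw [hM]
  set M : Matrix (Fin d) (Fin d) ℝ := fun i => ((e i : (insert f R : Finset _)) : Fin d → ℝ) with hMdef
  have hMf : M.updateRow i0 f = M := by
    have : M i0 = f := by simp [hMdef, hei0]
    conv_lhs => rw [← this]
    exact Matrix.updateRow_eq_self M i0
  have hz : ∀ x ∈ Submodule.span ℝ (R : Set (Fin d → ℝ)), (M.updateRow i0 x).det = 0 := by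
    intro x hx
    induction hx using Submodule.span_induction with
    | mem x hx =>
      have hx' : x ∈ insert f R := Finset.mem_insert_of_mem hx
      obtain ⟨j, hj⟩ := e.surjective ⟨x, hx'⟩
      have hji : j ≠ i0 := by
        rintro rfl
        rw [hei0] at hj
        have := congrArg Subtype.val hj
        simp at this
        exact hf (this ▸ hx)
      have hMj : M j = x := by simp [hMdef, hj]
      apply Matrix.det_zero_of_row_eq hji.symm
      rw [Matrix.updateRow_self, Matrix.updateRow_ne hji, hMj]
    | zero => exact Matrix.det_eq_zero_of_row_eq_zero i0 (by simp)
    | add x y _ _ hx hy => rw [Matrix.det_updateRow_add, hx, hy, add_zero]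
    | smul a x _ hx => rw [Matrix.det_updateRow_smul, hx, mul_zero]
  have h1 := hz _ ht
  rw [Matrix.det_updateRow_add, Matrix.det_updateRow_smul, hMf] at h1
  have h2 : (M.updateRow i0 w).det = -(t * M.det) := by linarith
  rw [h2, abs_neg, abs_mul]

/-- A ridge lies in exactly two facets. -/
lemma ridge_two (hS : Sys V) {R : Finset (Fin d → ℝ)} (hR : R.card + 1 = d) {f w w' : Fin d → ℝ}
    (hf : f ∉ R) (hw : w ∉ R) (hw' : w' ∉ R) (hfw : f ≠ w)
    (hF : Fac V (insert f R)) (hW : Fac V (insert w R)) (hW' : Fac V (insert w' R)) :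
    w' = f ∨ w' = w := by
  have hc : (insert f R).card = d := by rw [Finset.card_insert_of_notMem hf, hR]
  obtain ⟨hFV, y, hy, hyF⟩ := id hF
  have her : (insert f R).erase f = R := Finset.erase_insert hf
  obtain ⟨z, hz⟩ := exists_functional (hF.indep hS) (fun v => if v = f then -1 else 0)
  have hzf : z f = -1 := by rw [hz f (Finset.mem_insert_self _ _)]; simp
  have hzR : ∀ v ∈ (insert f R).erase f, z v = 0 := fun v hv => by
    rw [hz v (Finset.mem_of_mem_erase hv), if_neg (Finset.ne_of_mem_erase hv)]
  obtain ⟨x, hxV, hxF, hzx, s, hs, hval, h1⟩ :=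
    facet_pivot hS hc hFV hy hyF (Finset.mem_insert_self _ _) hzf hzR
  have key := fun (u : Fin d → ℝ) (hu : Fac V (insert u R)) (huR : u ∉ R) =>
    ridge_unique hS hc hFV hy hyF (Finset.mem_insert_self _ _) hzf hzR hxV hzx hval
      (h1 x (Finset.mem_insert_self _ _)) (w' := u) (by rw [her]; exact hu) (by rw [her]; exact huR)
  have k1 := key w hW hw
  have k2 := key w' hW' hw'
  rcases k1 with k1 | k1
  · exact absurd k1.symm hfw
  · rw [k1]; exact k2

lemma exists_weights (hS : Sys V) : ∃ α : Finset (Fin d → ℝ) → ℝ,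
    (∀ F, F.card = d → Fac V F → 0 < α F) ∧ (∀ F, ¬ (F.card = d ∧ Fac V F) → α F = 0) ∧
    ∀ R, R.card + 1 = d → Fac V R →
      ∑ w ∈ V, α (insert w R) • w ∈ Submodule.span ℝ (R : Set (Fin d → ℝ)) := by
  refine ⟨fun F => if F.card = d ∧ Fac V F then (absDet F)⁻¹ else 0, ?_, ?_, ?_⟩
  · intro F h1 h2
    simp only [h1, h2, and_self, if_true]
    exact inv_pos.mpr (absDet_pos h1 (h2.indep hS))
  · intro F h
    simp only [h, if_false]
  · intro R hR hRf
    obtain ⟨F, hRF, hc, hF⟩ := hRf.exists_facet hS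
    obtain ⟨f, hf⟩ : ∃ f, f ∈ F \ R := by
      rw [← Finset.Nonempty, ← Finset.card_pos, Finset.card_sdiff_of_subset hRF]; omega
    rw [Finset.mem_sdiff] at hf
    have hFe : F = insert f R := (Finset.eq_of_subset_of_card_le
      (Finset.insert_subset hf.1 hRF) (by rw [Finset.card_insert_of_notMem hf.2]; omega)).symm
    subst hFe
    replace hf := hf.2
    obtain ⟨hFV, y, hy, hyF⟩ := id hF
    have her : (insert f R).erase f = R := Finset.erase_insert hf
    obtain ⟨z, hz⟩ := exists_functional (hF.indep hS) (fun v => if v = f then -1 else 0)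
    have hzf : z f = -1 := by rw [hz f (Finset.mem_insert_self _ _)]; simp
    have hzR : ∀ v ∈ (insert f R).erase f, z v = 0 := fun v hv => by
      rw [hz v (Finset.mem_of_mem_erase hv), if_neg (Finset.ne_of_mem_erase hv)]
    obtain ⟨w, hwV, hwF, hzw, s, hs, hval, h1⟩ :=
      facet_pivot hS hc hFV hy hyF (Finset.mem_insert_self _ _) hzf hzR
    have hwR : w ∉ R := fun h => hwF (Finset.mem_insert_of_mem h)
    have hfw : f ≠ w := fun h => hwF (h ▸ Finset.mem_insert_self _ _)
    rw [her] at h1 hzR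
    have hW : Fac V (insert w R) :=
      ⟨Finset.insert_subset hwV hRf.1, _, hval, h1⟩
    have hcw : (insert w R).card = d := by rw [Finset.card_insert_of_notMem hwR, hR]
    have hsum : ∑ x ∈ V, (if (insert x R).card = d ∧ Fac V (insert x R) then
        (absDet (insert x R))⁻¹ else 0) • x =
        ∑ x ∈ ({f, w} : Finset (Fin d → ℝ)), (if (insert x R).card = d ∧ Fac V (insert x R) then
        (absDet (insert x R))⁻¹ else 0) • x := by
      symm
      apply Finset.sum_subset
      · intro x hx
        simp only [Finset.mem_insert, Finset.mem_singleton] at hx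
        rcases hx with rfl | rfl
        · exact hFV (Finset.mem_insert_self _ _)
        · exact hwV
      · intro x _ hx
        rw [if_neg, zero_smul]
        rintro ⟨hx1, hx2⟩
        have hxR : x ∉ R := fun h => by rw [Finset.insert_eq_of_mem h] at hx1; omega
        apply hx
        simpa using ridge_two hS hR hf hwR hxR hfw hF hW hx2
    rw [hsum, Finset.sum_pair hfw, if_pos ⟨hc, hF⟩, if_pos ⟨hcw, hW⟩]
    have hspan : w + z w • f ∈ Submodule.span ℝ (R : Set (Fin d → ℝ)) := by
      obtain ⟨c, hcx⟩ := expand (hF.indep hS) hc (w + z w • f)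
      rw [Finset.sum_insert hf] at hcx
      have h2 := congrArg z hcx
      simp only [map_add, map_smul, map_sum, hzf, smul_eq_mul] at h2
      have h4 : c f = 0 := by
        have : ∑ v ∈ R, c v * z v = 0 := Finset.sum_eq_zero fun v hv => by
          rw [hzR v hv, mul_zero]
        linarith
      rw [hcx, h4, zero_smul, zero_add]
      exact Submodule.sum_mem _ fun v hv => Submodule.smul_mem _ _ (Submodule.subset_span hv)
    have hdet := absDet_swap hR hf hwR hspan
    rw [abs_of_pos hzw] at hdet
    have hp := absDet_pos hc (hF.indep hS)
    have : (absDet (insert f R))⁻¹ • f + (absDet (insert w R))⁻¹ • w =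
        (absDet (insert w R))⁻¹ • (w + z w • f) := by
      rw [smul_add, smul_smul, add_comm]
      congr 2
      rw [hdet]
      field_simp
    rw [this]
    exact Submodule.smul_mem _ _ hspan

end RigAux

namespace RigAux
variable {d : ℕ} {V : Finset (Fin d → ℝ)}

structure Wt (V : Finset (Fin d → ℝ)) (α : Finset (Fin d → ℝ) → ℝ)
    (β : Finset (Fin d → ℝ) → (Fin d → ℝ) → ℝ) : Prop where
  pos : ∀ F, F.card = d → Fac V F → 0 < α F
  zero : ∀ F, ¬ (F.card = d ∧ Fac V F) → α F = 0
  bal : ∀ R, R.card + 1 = d → Fac V R → ∑ w ∈ V, α (insert w R) • w = ∑ r ∈ R, β R r • r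
  bzero : ∀ R, ¬ (R.card + 1 = d ∧ Fac V R) → ∀ r, β R r = 0

lemma exists_wt (hS : Sys V) : ∃ α β, Wt V α β := by
  obtain ⟨α, h1, h2, h3⟩ := exists_weights hS
  have : ∀ R, ∃ c : (Fin d → ℝ) → ℝ, (R.card + 1 = d → Fac V R →
      ∑ w ∈ V, α (insert w R) • w = ∑ r ∈ R, c r • r) ∧
      (¬ (R.card + 1 = d ∧ Fac V R) → ∀ r, c r = 0) := by
    intro R
    by_cases h : R.card + 1 = d ∧ Fac V R
    · have := h3 R h.1 h.2
      rw [Submodule.mem_span_finset] at this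
      obtain ⟨c, -, hc⟩ := this
      exact ⟨c, fun _ _ => hc.symm, fun h' => absurd h h'⟩
    · exact ⟨fun _ => 0, fun a b => absurd ⟨a, b⟩ h, fun _ _ => rfl⟩
  choose β hβ using this
  exact ⟨α, β, h1, h2, fun R => (hβ R).1, fun R => (hβ R).2⟩

/-- the edge-length functional -/
def L (V : Finset (Fin d → ℝ)) (α : Finset (Fin d → ℝ) → ℝ)
    (β : Finset (Fin d → ℝ) → (Fin d → ℝ) → ℝ) (R : Finset (Fin d → ℝ))
    (l : (Fin d → ℝ) → ℝ) : ℝ :=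
  ∑ w ∈ V, α (insert w R) * l w - ∑ r ∈ R, β R r * l r

variable {α : Finset (Fin d → ℝ) → ℝ} {β : Finset (Fin d → ℝ) → (Fin d → ℝ) → ℝ}

lemma L_add (R : Finset (Fin d → ℝ)) (l l' : (Fin d → ℝ) → ℝ) :
    L V α β R (fun v => l v + l' v) = L V α β R l + L V α β R l' := by
  simp only [L, mul_add, Finset.sum_add_distrib]; ring

lemma L_sub (R : Finset (Fin d → ℝ)) (l l' : (Fin d → ℝ) → ℝ) :
    L V α β R (fun v => l v - l' v) = L V α β R l - L V α β R l' := by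
  simp only [L, mul_sub, Finset.sum_sub_distrib]; ring

lemma L_smul (R : Finset (Fin d → ℝ)) (c : ℝ) (l : (Fin d → ℝ) → ℝ) :
    L V α β R (fun v => c * l v) = c * L V α β R l := by
  simp only [L, mul_left_comm _ c, ← Finset.mul_sum]; ring

lemma L_zero (hW : Wt V α β) {R : Finset (Fin d → ℝ)} (hc : R.card < d)
    (h : ¬ (R.card + 1 = d ∧ Fac V R)) (l : (Fin d → ℝ) → ℝ) : L V α β R l = 0 := by
  have h1 : ∀ w, α (insert w R) = 0 := by
    intro w
    apply hW.zero
    rintro ⟨h2, h3⟩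
    by_cases hw : w ∈ R
    · rw [Finset.insert_eq_of_mem hw] at h2; omega
    · rw [Finset.card_insert_of_notMem hw] at h2
      exact h ⟨h2, h3.mono (Finset.subset_insert _ _)⟩
  simp [L, h1, hW.bzero R h]

lemma L_lin (hW : Wt V α β) {R : Finset (Fin d → ℝ)} (hc : R.card < d)
    (θ : (Fin d → ℝ) →ₗ[ℝ] ℝ) : L V α β R (fun v => θ v) = 0 := by
  by_cases h : R.card + 1 = d ∧ Fac V R
  · have := congrArg θ (hW.bal R h.1 h.2)
    simp only [map_sum, map_smul, smul_eq_mul] at this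
    simp [L, this]
  · exact L_zero hW hc h _

lemma L_sub_lin (hW : Wt V α β) {R : Finset (Fin d → ℝ)} (hc : R.card < d)
    (l : (Fin d → ℝ) → ℝ) (θ : (Fin d → ℝ) →ₗ[ℝ] ℝ) :
    L V α β R (fun v => l v - θ v) = L V α β R l := by
  rw [L_sub, L_lin hW hc, sub_zero]

lemma card_insert_lt {G : Finset (Fin d → ℝ)} (hG : G.card + 2 = d) (v : Fin d → ℝ) :
    (insert v G).card < d := by
  have := Finset.card_insert_le v G; omega

lemma alpha_eq_zero (hW : Wt V α β) {G : Finset (Fin d → ℝ)} (hG : G.card + 2 = d)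
    {v w : Fin d → ℝ} (h : v ∈ G ∨ w ∈ G ∨ v = w) : α (insert w (insert v G)) = 0 := by
  apply hW.zero
  rintro ⟨h1, -⟩
  have h3 := Finset.card_insert_le v G
  have h4 := Finset.card_insert_le w G
  rcases h with h | h | h
  · rw [Finset.insert_eq_of_mem h] at h1; omega
  · rw [Finset.insert_comm, Finset.insert_eq_of_mem h] at h1; omega
  · subst h; rw [Finset.insert_idem] at h1; omega

lemma L_planar (hW : Wt V α β) {G : Finset (Fin d → ℝ)} (hG : G.card + 2 = d)
    {l : (Fin d → ℝ) → ℝ} (hl : ∀ g ∈ G, l g = 0) (v : Fin d → ℝ) :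
    L V α β (insert v G) l =
      ∑ w ∈ V, α (insert w (insert v G)) * l w - β (insert v G) v * l v := by
  by_cases hv : v ∈ G
  · rw [hl v hv, L_zero hW (card_insert_lt hG v)]
    · rw [Finset.sum_eq_zero]
      · simp
      · intro w _; rw [alpha_eq_zero hW hG (Or.inl hv), zero_mul]
    · rw [Finset.insert_eq_of_mem hv]; omega
  · rw [L, Finset.sum_insert hv, Finset.sum_eq_zero (s := G), add_zero]
    intro g hg; rw [hl g hg, mul_zero]

lemma closure_mem (hS : Sys V) (hW : Wt V α β) {G : Finset (Fin d → ℝ)} (hG : G.card + 2 = d)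
    (hGf : Fac V G) (l : (Fin d → ℝ) → ℝ) :
    ∑ v ∈ V, L V α β (insert v G) l • v ∈ Submodule.span ℝ (G : Set (Fin d → ℝ)) := by
  obtain ⟨θ, hθ⟩ := exists_functional (hGf.indep hS) l
  have h0 : ∀ g ∈ G, (fun v => l v - θ v) g = 0 := fun g hg => by simp [hθ g hg]
  have h1 : ∀ v, L V α β (insert v G) l = L V α β (insert v G) (fun v => l v - θ v) :=
    fun v => (L_sub_lin hW (card_insert_lt hG v) l θ).symm
  simp only [h1]
  set l' := fun v => l v - θ v with hl'
  simp only [L_planar hW hG h0, sub_smul, Finset.sum_sub_distrib, Finset.sum_smul]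
  rw [Finset.sum_comm, ← Finset.sum_sub_distrib]
  apply Submodule.sum_mem
  intro w _
  have h2 : ∑ v ∈ V, (α (insert w (insert v G)) * l' w) • v -
      (β (insert w G) w * l' w) • w =
      l' w • (∑ v ∈ V, α (insert v (insert w G)) • v - β (insert w G) w • w) := by
    rw [smul_sub, Finset.smul_sum, smul_smul, mul_comm]
    congr 1
    apply Finset.sum_congr rfl
    intro v _
    rw [smul_smul, mul_comm, Finset.insert_comm]
  rw [h2]
  by_cases hw : w ∈ G
  · rw [h0 w hw, zero_smul]; exact Submodule.zero_mem _
  apply Submodule.smul_mem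
  by_cases h : (insert w G).card + 1 = d ∧ Fac V (insert w G)
  · rw [hW.bal _ h.1 h.2, Finset.sum_insert hw, add_sub_cancel_left]
    exact Submodule.sum_mem _ fun v hv => Submodule.smul_mem _ _ (Submodule.subset_span hv)
  · rw [hW.bzero _ h, zero_smul, sub_zero, Finset.sum_eq_zero]
    · exact Submodule.zero_mem _
    · intro v _
      rw [hW.zero, zero_smul]
      rintro ⟨h3, h4⟩
      apply h
      refine ⟨?_, h4.mono (Finset.subset_insert _ _)⟩
      have := Finset.card_insert_le v (insert w G)
      have := card_insert_lt hG w
      omega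

lemma closure_lin (hS : Sys V) (hW : Wt V α β) {G : Finset (Fin d → ℝ)} (hG : G.card + 2 = d)
    (hGf : Fac V G) (l : (Fin d → ℝ) → ℝ) (t : (Fin d → ℝ) →ₗ[ℝ] ℝ) (ht : ∀ g ∈ G, t g = 0) :
    ∑ v ∈ V, t v * L V α β (insert v G) l = 0 := by
  have h1 := closure_mem hS hW hG hGf l
  have h2 : Submodule.span ℝ (G : Set (Fin d → ℝ)) ≤ LinearMap.ker t :=
    Submodule.span_le.mpr fun g hg => ht g hg
  have h3 := h2 h1
  rw [LinearMap.mem_ker] at h3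
  simp only [map_sum, map_smul, smul_eq_mul] at h3
  rw [← h3]
  exact Finset.sum_congr rfl fun v _ => mul_comm _ _

lemma form_symm (hW : Wt V α β) {G : Finset (Fin d → ℝ)} (hG : G.card + 2 = d)
    {k l : (Fin d → ℝ) → ℝ} (hk : ∀ g ∈ G, k g = 0) (hl : ∀ g ∈ G, l g = 0) :
    ∑ v ∈ V, k v * L V α β (insert v G) l = ∑ v ∈ V, l v * L V α β (insert v G) k := by
  simp only [L_planar hW hG hk, L_planar hW hG hl, mul_sub, Finset.sum_sub_distrib, Finset.mul_sum]
  congr 1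
  · rw [Finset.sum_comm]
    refine Finset.sum_congr rfl fun v _ => Finset.sum_congr rfl fun w _ => ?_
    rw [Finset.insert_comm]; ring
  · exact Finset.sum_congr rfl fun v _ => by ring

/-- general bilinear form symmetric -/
lemma form_symm' (hW : Wt V α β) {G : Finset (Fin d → ℝ)}
    (hG : G.card + 2 = d) {k l : (Fin d → ℝ) → ℝ}
    {θ c : (Fin d → ℝ) →ₗ[ℝ] ℝ} (hθ : ∀ g ∈ G, θ g = k g) (hc : ∀ g ∈ G, c g = l g) :
    ∑ v ∈ V, (k v - θ v) * L V α β (insert v G) l =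
      ∑ v ∈ V, (l v - c v) * L V α β (insert v G) k := by
  have := form_symm (V := V) hW hG (k := fun v => k v - θ v) (l := fun v => l v - c v)
    (fun g hg => by simp [hθ g hg]) (fun g hg => by simp [hc g hg])
  simpa only [L_sub_lin hW (card_insert_lt hG _)] using this

lemma ridge_facet (hS : Sys V) {R : Finset (Fin d → ℝ)} (hR : R.card + 1 = d) (hRf : Fac V R) :
    ∃ f, f ∉ R ∧ Fac V (insert f R) := by
  obtain ⟨F, hRF, hc, hF⟩ := hRf.exists_facet hS
  obtain ⟨f, hf⟩ : ∃ f, f ∈ F \ R := by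
    rw [← Finset.Nonempty, ← Finset.card_pos, Finset.card_sdiff_of_subset hRF]; omega
  rw [Finset.mem_sdiff] at hf
  exact ⟨f, hf.2, hF.mono (Finset.insert_subset hf.1 hRF)⟩

/-- pivot with constructed z -/
lemma facet_pivot' (hS : Sys V) {F : Finset (Fin d → ℝ)} (hc : F.card = d) (hFf : Fac V F)
    {y : (Fin d → ℝ) →ₗ[ℝ] ℝ} (hy : Valid V y)
    (hyF : ∀ v ∈ F, y v = 1) {f : Fin d → ℝ} (hf : f ∈ F) :
    ∃ z : (Fin d → ℝ) →ₗ[ℝ] ℝ, z f = -1 ∧ (∀ v ∈ F.erase f, z v = 0) ∧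
    ∃ w ∈ V, w ∉ F ∧ 0 < z w ∧ ∃ s : ℝ, 0 < s ∧ Valid V (y + s • z) ∧
      (∀ v ∈ insert w (F.erase f), (y + s • z) v = 1) ∧ Fac V (insert w (F.erase f)) ∧
      (insert w (F.erase f)).card = d := by
  obtain ⟨z, hz⟩ := exists_functional (hFf.indep hS) (fun v => if v = f then -1 else 0)
  have hzf : z f = -1 := by rw [hz f hf]; simp
  have hzR : ∀ v ∈ F.erase f, z v = 0 := fun v hv => by
    rw [hz v (Finset.mem_of_mem_erase hv), if_neg (Finset.ne_of_mem_erase hv)]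
  obtain ⟨w, hwV, hwF, hzw, s, hs, hval, h1⟩ := facet_pivot hS hc hFf.1 hy hyF hf hzf hzR
  refine ⟨z, hzf, hzR, w, hwV, hwF, hzw, s, hs, hval, h1, ⟨?_, _, hval, h1⟩, ?_⟩
  · exact Finset.insert_subset hwV ((Finset.erase_subset _ _).trans hFf.1)
  · rw [Finset.card_insert_of_notMem (fun h => hwF (Finset.mem_of_mem_erase h)),
      Finset.card_erase_add_one hf, hc]

lemma L_one_pos (hS : Sys V) (hW : Wt V α β) {R : Finset (Fin d → ℝ)} (hR : R.card + 1 = d)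
    (hRf : Fac V R) : 0 < L V α β R (fun _ => 1) := by
  obtain ⟨f, hf, hF⟩ := ridge_facet hS hR hRf
  have hc : (insert f R).card = d := by rw [Finset.card_insert_of_notMem hf, hR]
  obtain ⟨hFV, y, hy, hyF⟩ := id hF
  obtain ⟨z, -, -, w, hwV, hwF, -, -, -, -, -, hwfac, hwc⟩ :=
    facet_pivot' hS hc hF hy hyF (Finset.mem_insert_self f R)
  rw [Finset.erase_insert hf] at hwfac hwc
  rw [← L_sub_lin hW (by omega) _ y, L, Finset.sum_eq_zero (s := R), sub_zero]
  · apply Finset.sum_pos'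
    · intro v hv
      apply mul_nonneg
      · by_cases h : (insert v R).card = d ∧ Fac V (insert v R)
        · exact (hW.pos _ h.1 h.2).le
        · rw [hW.zero _ h]
      · have := hy v hv; linarith
    · refine ⟨w, hwV, mul_pos (hW.pos _ hwc hwfac) ?_⟩
      have h1 := hy w hwV
      rcases lt_or_eq_of_le h1 with h | h
      · linarith
      · exact absurd (Fac.tight hS hc hFV hy hyF w hwV h) hwF
  · intro r hr
    rw [hyF r (Finset.mem_insert_of_mem hr)]; ring

lemma L_one_nonneg (hS : Sys V) (hW : Wt V α β) {R : Finset (Fin d → ℝ)} (hR : R.card < d) :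
    0 ≤ L V α β R (fun _ => 1) := by
  by_cases h : R.card + 1 = d ∧ Fac V R
  · exact (L_one_pos hS hW h.1 h.2).le
  · rw [L_zero hW hR h]

lemma dirichlet {ι : Type*} (N : Finset ι) (a : ι → ι → ℝ) (b f g : ι → ℝ)
    (hsymm : ∀ z w, a z w = a w z) (hpos : ∀ z w, 0 ≤ a z w)
    (hg : ∀ z ∈ N, ∑ w ∈ N, a z w * g w = b z * g z)
    (hf0 : ∀ z ∈ N, g z = 0 → f z = 0)
    (hcross : ∀ z ∈ N, ∀ w ∈ N, a z w ≠ 0 → g z * g w < 0 → f z = 0 ∧ f w = 0) :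
    ∑ z ∈ N, f z * (∑ w ∈ N, a z w * f w - b z * f z) ≤ 0 ∧
    (∑ z ∈ N, f z * (∑ w ∈ N, a z w * f w - b z * f z) = 0 →
      ∀ z ∈ N, g z ≠ 0 → ∑ w ∈ N, a z w * f w - b z * f z = 0) := by
  set φ : ι → ℝ := fun z => f z / g z with hφ
  have hfφ : ∀ z ∈ N, f z = φ z * g z := by
    intro z hz
    by_cases h : g z = 0
    · rw [hf0 z hz h, h, mul_zero]
    · simp only [hφ]; field_simp
  have hL : ∀ z ∈ N, ∑ w ∈ N, a z w * f w - b z * f z =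
      ∑ w ∈ N, a z w * g w * (φ w - φ z) := by
    intro z hz
    have h1 : b z * f z = φ z * ∑ w ∈ N, a z w * g w := by rw [hg z hz, hfφ z hz]; ring
    rw [h1, Finset.mul_sum, ← Finset.sum_sub_distrib]
    exact Finset.sum_congr rfl fun w hw => by rw [hfφ w hw]; ring
  have hterm : ∀ z ∈ N, ∀ w ∈ N, 0 ≤ a z w * g z * g w * (φ z - φ w) ^ 2 := by
    intro z hz w hw
    by_cases h0 : a z w = 0
    · rw [h0]; simp
    · by_cases h1 : g z * g w < 0
      · obtain ⟨h2, h3⟩ := hcross z hz w hw h0 h1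
        have : φ z - φ w = 0 := by simp [hφ, h2, h3]
        rw [this]; simp
      · have := mul_nonneg (mul_nonneg (hpos z w) (not_lt.mp h1)) (sq_nonneg (φ z - φ w))
        rw [← mul_assoc] at this; exact this
  have hQ : ∑ z ∈ N, f z * (∑ w ∈ N, a z w * f w - b z * f z) =
      - (1/2) * ∑ z ∈ N, ∑ w ∈ N, a z w * g z * g w * (φ z - φ w) ^ 2 := by
    have e1 : ∑ z ∈ N, f z * (∑ w ∈ N, a z w * f w - b z * f z) =
        ∑ z ∈ N, ∑ w ∈ N, a z w * g z * g w * (φ z * φ w - φ z ^ 2) := by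
      refine Finset.sum_congr rfl fun z hz => ?_
      rw [hL z hz, Finset.mul_sum]
      exact Finset.sum_congr rfl fun w hw => by rw [hfφ z hz]; ring
    have e2 : ∑ z ∈ N, ∑ w ∈ N, a z w * g z * g w * (φ z * φ w - φ z ^ 2) =
        ∑ z ∈ N, ∑ w ∈ N, a z w * g z * g w * (φ z * φ w - φ w ^ 2) := by
      rw [Finset.sum_comm]
      refine Finset.sum_congr rfl fun z hz => Finset.sum_congr rfl fun w hw => ?_
      rw [hsymm w z]; ring
    have e3 : ∑ z ∈ N, ∑ w ∈ N, a z w * g z * g w * (φ z - φ w) ^ 2 =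
        - ∑ z ∈ N, ∑ w ∈ N, a z w * g z * g w * (φ z * φ w - φ z ^ 2)
        - ∑ z ∈ N, ∑ w ∈ N, a z w * g z * g w * (φ z * φ w - φ w ^ 2) := by
      simp only [← Finset.sum_neg_distrib, ← Finset.sum_sub_distrib]
      refine Finset.sum_congr rfl fun z hz => Finset.sum_congr rfl fun w hw => ?_
      ring
    rw [e3, e1, ← e2]; ring
  have hnn : 0 ≤ ∑ z ∈ N, ∑ w ∈ N, a z w * g z * g w * (φ z - φ w) ^ 2 :=
    Finset.sum_nonneg fun z hz => Finset.sum_nonneg fun w hw => hterm z hz w hw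
  refine ⟨by rw [hQ]; linarith, fun h0 z hz hgz => ?_⟩
  rw [hQ] at h0
  have h1 : ∑ z ∈ N, ∑ w ∈ N, a z w * g z * g w * (φ z - φ w) ^ 2 = 0 := by linarith
  have h2 := (Finset.sum_eq_zero_iff_of_nonneg
    (fun z hz => Finset.sum_nonneg fun w hw => hterm z hz w hw)).mp h1 z hz
  have h3 := (Finset.sum_eq_zero_iff_of_nonneg (fun w hw => hterm z hz w hw)).mp h2
  rw [hL z hz]
  refine Finset.sum_eq_zero fun w hw => ?_
  have h4 := h3 w hw
  have h5 : a z w * g w * (φ z - φ w) ^ 2 = 0 := by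
    have : g z * (a z w * g w * (φ z - φ w) ^ 2) = 0 := by rw [← h4]; ring
    exact (mul_eq_zero.mp this).resolve_left hgz
  rcases mul_eq_zero.mp h5 with h | h
  · rw [h, zero_mul]
  · have : φ z - φ w = 0 := by simpa using h
    have : φ w - φ z = 0 := by linarith
    rw [this, mul_zero]

end RigAux

namespace RigAux
variable {d : ℕ} {V : Finset (Fin d → ℝ)}
variable {α : Finset (Fin d → ℝ) → ℝ} {β : Finset (Fin d → ℝ) → (Fin d → ℝ) → ℝ}

lemma carrier_mod (hS : Sys V) {S T G : Finset (Fin d → ℝ)} (hSG : Disjoint S G)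
    (hTG : Disjoint T G) (hSf : Fac V (S ∪ G)) (hTf : Fac V (T ∪ G))
    (a b : (Fin d → ℝ) → ℝ) (ha : ∀ v ∈ S, 0 < a v) (hb : ∀ v ∈ T, 0 ≤ b v)
    (hab : ∑ v ∈ S, a v • v - ∑ v ∈ T, b v • v ∈ Submodule.span ℝ (G : Set (Fin d → ℝ))) :
    S ⊆ T := by
  rw [Submodule.mem_span_finset] at hab
  obtain ⟨e, -, he⟩ := hab
  set C : ℝ := 1 + ∑ g ∈ G, |e g| with hC
  have hCpos : 0 < C := by
    have : 0 ≤ ∑ g ∈ G, |e g| := Finset.sum_nonneg fun _ _ => abs_nonneg _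
    linarith
  have hCe : ∀ g ∈ G, 0 ≤ C + e g := by
    intro g hg
    have h1 : |e g| ≤ ∑ g ∈ G, |e g| :=
      Finset.single_le_sum (f := fun g => |e g|) (fun _ _ => abs_nonneg _) hg
    have h2 := neg_abs_le (e g)
    linarith
  have key := carrier_subset hS hSf hTf (fun v => if v ∈ G then C else a v)
    (fun v => if v ∈ G then C + e v else b v) ?_ ?_ ?_
  · intro v hv
    rcases Finset.mem_union.mp (key (Finset.mem_union_left _ hv)) with h | h
    · exact h
    · exact absurd h (Finset.disjoint_left.mp hSG hv)
  · intro v hv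
    by_cases h : v ∈ G
    · simp [h, hCpos]
    · simp only [h, if_false]
      exact ha v ((Finset.mem_union.mp hv).resolve_right h)
  · intro v hv
    by_cases h : v ∈ G
    · simp [h, hCe v h]
    · simp only [h, if_false]
      exact hb v ((Finset.mem_union.mp hv).resolve_right h)
  · rw [Finset.sum_union hSG, Finset.sum_union hTG]
    have e1 : ∑ v ∈ S, (if v ∈ G then C else a v) • v = ∑ v ∈ S, a v • v :=
      Finset.sum_congr rfl fun v hv => by rw [if_neg (Finset.disjoint_left.mp hSG hv)]
    have e2 : ∑ v ∈ T, (if v ∈ G then C + e v else b v) • v = ∑ v ∈ T, b v • v :=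
      Finset.sum_congr rfl fun v hv => by rw [if_neg (Finset.disjoint_left.mp hTG hv)]
    have e3 : ∑ v ∈ G, (if v ∈ G then C else a v) • v = ∑ v ∈ G, C • v :=
      Finset.sum_congr rfl fun v hv => by rw [if_pos hv]
    have e4 : ∑ v ∈ G, (if v ∈ G then C + e v else b v) • v =
        ∑ v ∈ G, C • v + ∑ v ∈ G, e v • v := by
      rw [← Finset.sum_add_distrib]
      exact Finset.sum_congr rfl fun v hv => by rw [if_pos hv, add_smul]
    rw [e1, e2, e3, e4, he]; abel

/-- the facet around `G` that is opposite to `u1` -/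
lemma opposite_facet (hS : Sys V) {G : Finset (Fin d → ℝ)} (hGf : Fac V G) (u1 : Fin d → ℝ)
    (hu1 : u1 ∈ V) :
    ∃ F y, G ⊆ F ∧ F.card = d ∧ Fac V F ∧ Valid V y ∧ (∀ v ∈ F, y v = 1) ∧
      (∃ c : (Fin d → ℝ) → ℝ, u1 = ∑ f ∈ F, c f • f ∧ ∀ f ∈ F \ G, c f ≤ 0) := by
  let Fs := V.powerset.filter fun F => G ⊆ F ∧ F.card = d ∧ Fac V F
  let Y : Finset (Fin d → ℝ) → ((Fin d → ℝ) →ₗ[ℝ] ℝ) := fun F =>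
    if h : Fac V F then h.2.choose else 0
  have hY : ∀ F, Fac V F → Valid V (Y F) ∧ ∀ v ∈ F, Y F v = 1 := by
    intro F h
    simp only [Y, dif_pos h]
    exact h.2.choose_spec
  have hne : Fs.Nonempty := by
    obtain ⟨F, h1, h2, h3⟩ := hGf.exists_facet hS
    exact ⟨F, by simp [Fs, h1, h2, h3, h3.1]⟩
  obtain ⟨F, hF, hmin⟩ := Finset.exists_min_image Fs (fun F => Y F u1) hne
  simp only [Fs, Finset.mem_filter, Finset.mem_powerset] at hF hmin
  obtain ⟨hFV, hGF, hcF, hFf⟩ := hF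
  obtain ⟨c, hc⟩ := expand (hFf.indep hS) hcF u1
  refine ⟨F, Y F, hGF, hcF, hFf, (hY F hFf).1, (hY F hFf).2, c, hc, ?_⟩
  intro f hf
  rw [Finset.mem_sdiff] at hf
  obtain ⟨z, hzf, hzR, w, hwV, hwF, hzw, s, hs, hval, h1, hfac, hcard⟩ :=
    facet_pivot' hS hcF hFf (hY F hFf).1 (hY F hFf).2 hf.1
  have h2 : Y (insert w (F.erase f)) = Y F + s • z := by
    apply functional_ext (hfac.indep hS) hcard
    intro v hv
    rw [(hY _ hfac).2 v hv, h1 v hv]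
  have h3 := hmin (insert w (F.erase f)) ⟨hfac.1, ?_, hcard, hfac⟩
  · rw [h2] at h3
    simp only [LinearMap.add_apply, LinearMap.smul_apply, smul_eq_mul] at h3
    have h4 : 0 ≤ z u1 := by
      by_contra hcon
      nlinarith
    have h5 : z u1 = - c f := by
      rw [hc, map_sum, Finset.sum_eq_single f]
      · simp [hzf]
      · intro v hv hvf
        rw [map_smul, hzR v (Finset.mem_erase.mpr ⟨hvf, hv⟩), smul_zero]
      · intro h; exact absurd hf.1 h
    linarith
  · intro g hg
    exact Finset.mem_insert_of_mem
      (Finset.mem_erase.mpr ⟨fun h => hf.2 (h ▸ hg), hGF hg⟩)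

lemma ker_span (hS : Sys V) {R : Finset (Fin d → ℝ)} (hR : R.card + 1 = d) (hRf : Fac V R)
    {g : (Fin d → ℝ) →ₗ[ℝ] ℝ} (hg : g ≠ 0) (hgR : ∀ r ∈ R, g r = 0) {x : Fin d → ℝ}
    (hx : g x = 0) : ∃ c : (Fin d → ℝ) → ℝ, x = ∑ r ∈ R, c r • r := by
  obtain ⟨q, hq, hF⟩ := ridge_facet hS hR hRf
  have hc : (insert q R).card = d := by rw [Finset.card_insert_of_notMem hq, hR]
  obtain ⟨c, hcx⟩ := expand (hF.indep hS) hc x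
  have hgq : g q ≠ 0 := by
    intro h
    apply hg
    apply functional_ext (hF.indep hS) hc
    intro v hv
    rcases Finset.mem_insert.mp hv with rfl | hv
    · simpa using h
    · simpa using hgR v hv
  rw [Finset.sum_insert hq] at hcx
  have h1 : c q = 0 := by
    have := congrArg g hcx
    rw [hx, map_add, map_sum, Finset.sum_eq_zero (s := R), map_smul, smul_eq_mul, add_zero] at this
    · exact (mul_eq_zero.mp this.symm).resolve_right hgq
    · intro r hr; rw [map_smul, hgR r hr, smul_zero]
  rw [h1, zero_smul, zero_add] at hcx
  exact ⟨c, hcx⟩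

lemma planar (hS : Sys V) (hW : Wt V α β) {G : Finset (Fin d → ℝ)} (hG : G.card + 2 = d)
    (hGf : Fac V G) (k : (Fin d → ℝ) → ℝ) (θ c : (Fin d → ℝ) →ₗ[ℝ] ℝ)
    (hθ : ∀ g ∈ G, θ g = k g) (hc : ∀ g ∈ G, c g = 1)
    (h0 : ∑ v ∈ V, (1 - c v) * L V α β (insert v G) k = 0) :
    ∑ v ∈ V, (k v - θ v) * L V α β (insert v G) k ≤ 0 ∧
    (∑ v ∈ V, (k v - θ v) * L V α β (insert v G) k = 0 →
      ∀ v ∈ V, L V α β (insert v G) k = 0) := by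
  obtain ⟨u1, hu1G, hu1V, hu1f⟩ : ∃ u, u ∉ G ∧ u ∈ V ∧ Fac V (insert u G) := by
    obtain ⟨F, hGF, hcF, hF⟩ := hGf.exists_facet hS
    obtain ⟨f, hf⟩ : ∃ f, f ∈ F \ G := by
      rw [← Finset.Nonempty, ← Finset.card_pos, Finset.card_sdiff_of_subset hGF]; omega
    rw [Finset.mem_sdiff] at hf
    exact ⟨f, hf.2, hF.1 hf.1, hF.mono (Finset.insert_subset hf.1 hGF)⟩
  obtain ⟨F, y, hGF, hcF, hFf, hy, hyF, lam, hlam, hlam0⟩ := opposite_facet hS hGf u1 hu1V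
  have hu1c : (insert u1 G).card + 1 = d := by rw [Finset.card_insert_of_notMem hu1G]; omega
  have hu1F : u1 ∉ F := by
    intro h
    have h1 : ∑ f ∈ F, (lam f - if f = u1 then 1 else 0) • f = 0 := by
      simp only [sub_smul, Finset.sum_sub_distrib, ← hlam, ite_smul, one_smul, zero_smul]
      rw [Finset.sum_ite_eq' F u1 (fun x => x), if_pos h, sub_self]
    have h2 := coeff_eq_zero (hFf.indep hS) _ h1 u1 h
    have h3 := hlam0 u1 (Finset.mem_sdiff.mpr ⟨h, hu1G⟩)
    simp at h2
    linarith
  have hyu : y u1 < 1 := by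
    rcases lt_or_eq_of_le (hy u1 hu1V) with h | h
    · exact h
    · exact absurd (Fac.tight hS hcF hFf.1 hy hyF u1 hu1V h) hu1F
  obtain ⟨g, hg0, hgR⟩ := exists_annih (s := insert u1 G) (by omega)
  have hgG : ∀ v ∈ G, g v = 0 := fun v hv => hgR v (Finset.mem_insert_of_mem hv)
  have hdisj : Disjoint (F \ G) G := Finset.sdiff_disjoint
  have hFG : F \ G ∪ G = F := Finset.sdiff_union_of_subset hGF
  -- carrier consequence
  have hcar : ∀ S : Finset (Fin d → ℝ), Disjoint S G → Fac V (S ∪ G) →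
      ∀ a : (Fin d → ℝ) → ℝ, (∀ v ∈ S, 0 < a v) → g (∑ v ∈ S, a v • v) = 0 →
      S ⊆ {u1} ∨ S ⊆ F \ G := by
    intro S hSG hSf a ha hg1
    obtain ⟨e, he⟩ := ker_span hS hu1c hu1f hg0 hgR hg1
    rw [Finset.sum_insert hu1G] at he
    rcases lt_or_ge 0 (e u1) with hpos | hneg
    · left
      apply carrier_mod hS hSG (T := {u1}) (by simpa using hu1G) hSf
        (by simpa [Finset.singleton_union] using hu1f) a e ha (by simpa using hpos.le)
      rw [he, Finset.sum_singleton, add_sub_cancel_left]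
      exact Submodule.sum_mem _ fun v hv => Submodule.smul_mem _ _ (Submodule.subset_span hv)
    · right
      apply carrier_mod hS hSG hdisj hSf (by rw [hFG]; exact hFf) a (fun f => e u1 * lam f) ha
      · intro f hf
        exact mul_nonneg_of_nonpos_of_nonpos hneg (hlam0 f hf)
      · have h1 : u1 = ∑ f ∈ F \ G, lam f • f + ∑ f ∈ G, lam f • f := by
          rw [← Finset.sum_union hdisj, hFG]; exact hlam
        have h2 : e u1 • u1 = ∑ f ∈ F \ G, (e u1 * lam f) • f + ∑ f ∈ G, (e u1 * lam f) • f := by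
          have := congrArg (fun x => e u1 • x) h1
          simpa only [smul_add, Finset.smul_sum, smul_smul] using this
        rw [he, h2]
        have : ∀ a b c : Fin d → ℝ, a + b + c - a = b + c := fun a b c => by abel
        rw [this]
        refine Submodule.add_mem _ ?_ ?_ <;>
        exact Submodule.sum_mem _ fun v hv => Submodule.smul_mem _ _ (Submodule.subset_span hv)
  set N := V.filter fun v => v ∉ G ∧ Fac V (insert v G) with hN
  have memN : ∀ {v}, v ∈ N ↔ v ∈ V ∧ v ∉ G ∧ Fac V (insert v G) := by
    intro v; simp [hN]
  have hA : ∀ z ∈ N, g z = 0 → z = u1 ∨ z ∈ F := by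
    intro z hz hgz
    obtain ⟨-, hzG, hzf⟩ := memN.mp hz
    have := hcar {z} (by simpa using hzG) (by simpa [Finset.singleton_union] using hzf)
      (fun _ => 1) (by simp) (by simpa using hgz)
    rcases this with h | h
    · left; simpa using h
    · right
      have := h (Finset.mem_singleton_self z)
      exact (Finset.mem_sdiff.mp this).1
  have hB : ∀ z w, z ∉ G → w ∉ G → z ≠ w → Fac V (insert w (insert z G)) → g z * g w < 0 →
      z ∈ F ∧ w ∈ F := by
    intro z w hzG hwG hzw hfac hneg
    have hgz : g z ≠ 0 := by rintro h; rw [h] at hneg; simp at hneg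
    have hgw : g w ≠ 0 := by rintro h; rw [h] at hneg; simp at hneg
    have := hcar {z, w} (by simp [hzG, hwG]) (hfac.mono (by
        intro v; simp only [Finset.mem_union, Finset.mem_insert, Finset.mem_singleton]; tauto))
      (fun v => if v = z then |g w| else |g z|) (by
        intro v hv
        by_cases h : v = z
        · simp [h, hgw]
        · simp [h, hgz]) (by
        rw [Finset.sum_pair hzw]
        simp only [if_true, map_add, map_smul, smul_eq_mul, if_neg hzw.symm]
        rcases lt_or_gt_of_ne hgz with h | h
        · have h' : 0 < g w := by by_contra hc; nlinarith
          rw [abs_of_pos h', abs_of_neg h]; ring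
        · have h' : g w < 0 := by by_contra hc; nlinarith
          rw [abs_of_neg h', abs_of_pos h]; ring)
    rcases this with h | h
    · have : z = u1 := by simpa using h (Finset.mem_insert_self z _)
      exact absurd (this ▸ hgR u1 (Finset.mem_insert_self _ _)) hgz
    · exact ⟨(Finset.mem_sdiff.mp (h (by simp))).1, (Finset.mem_sdiff.mp (h (by simp))).1⟩
  obtain ⟨b, hb⟩ := exists_functional (hFf.indep hS) k
  set r := (k u1 - b u1) / (1 - y u1) with hr
  set f : (Fin d → ℝ) → ℝ := fun v => (k v - b v) - r * (1 - y v) with hf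
  have hfF : ∀ v ∈ F, f v = 0 := by
    intro v hv; simp [hf, hb v hv, hyF v hv]
  have hfu : f u1 = 0 := by
    have : 1 - y u1 ≠ 0 := by linarith
    simp only [hf, hr]; field_simp; ring
  have hfG : ∀ v ∈ G, f v = 0 := fun v hv => hfF v (hGF hv)
  have hLf : ∀ v, L V α β (insert v G) f =
      L V α β (insert v G) k - r * L V α β (insert v G) (fun _ => 1) := by
    intro v
    have hlt := card_insert_lt hG v
    simp only [hf]
    rw [L_sub _ (fun v => k v - b v), L_sub_lin hW hlt, L_smul _ r, L_sub_lin hW hlt]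
  -- cross terms
  have hyk : ∑ v ∈ V, (1 - y v) * L V α β (insert v G) k = 0 := by
    have := closure_lin hS hW hG hGf k (c - y) (fun v hv => by simp [hc v hv, hyF v (hGF hv)])
    have e : ∑ v ∈ V, (1 - y v) * L V α β (insert v G) k =
        ∑ v ∈ V, (1 - c v) * L V α β (insert v G) k +
        ∑ v ∈ V, (c - y) v * L V α β (insert v G) k := by
      rw [← Finset.sum_add_distrib]
      exact Finset.sum_congr rfl fun v _ => by simp only [LinearMap.sub_apply]; ring
    rw [e, h0, this, add_zero]
  have hk1 : ∑ v ∈ V, (k v - b v) * L V α β (insert v G) (fun _ => 1) = 0 := by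
    rw [form_symm' (V := V) hW hG (k := k) (l := fun _ => 1) (θ := b) (c := y)
      (fun v hv => hb v (hGF hv)) (fun v hv => hyF v (hGF hv))]
    exact hyk
  have hkk : ∑ v ∈ V, (k v - θ v) * L V α β (insert v G) k =
      ∑ v ∈ V, (k v - b v) * L V α β (insert v G) k := by
    have := closure_lin hS hW hG hGf k (b - θ)
      (fun v hv => by simp [hb v (hGF hv), hθ v hv])
    rw [← sub_eq_zero, ← this, ← Finset.sum_sub_distrib]
    exact Finset.sum_congr rfl fun v _ => by simp; ring
  have hQ : ∑ v ∈ V, f v * L V α β (insert v G) f =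
      ∑ v ∈ V, (k v - θ v) * L V α β (insert v G) k +
      r ^ 2 * ∑ v ∈ V, (1 - y v) * L V α β (insert v G) (fun _ => 1) := by
    have e : ∑ v ∈ V, f v * L V α β (insert v G) f =
        ∑ v ∈ V, (k v - b v) * L V α β (insert v G) k -
        r * ∑ v ∈ V, (1 - y v) * L V α β (insert v G) k -
        r * ∑ v ∈ V, (k v - b v) * L V α β (insert v G) (fun _ => 1) +
        r ^ 2 * ∑ v ∈ V, (1 - y v) * L V α β (insert v G) (fun _ => 1) := by
      simp only [Finset.mul_sum, ← Finset.sum_sub_distrib, ← Finset.sum_add_distrib]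
      refine Finset.sum_congr rfl fun v _ => ?_
      rw [hLf v]; simp only [hf]; ring
    rw [e, hyk, hk1, hkk]; ring
  have hHpos : 0 < ∑ v ∈ V, (1 - y v) * L V α β (insert v G) (fun _ => 1) := by
    apply Finset.sum_pos'
    · intro v hv
      exact mul_nonneg (by have := hy v hv; linarith) (L_one_nonneg hS hW (card_insert_lt hG v))
    · exact ⟨u1, hu1V, mul_pos (by linarith) (L_one_pos hS hW hu1c hu1f)⟩
  have hnotN : ∀ v ∈ V, v ∉ N → ∀ l, L V α β (insert v G) l = 0 := by
    intro v hv hvN l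
    apply L_zero hW (card_insert_lt hG v)
    rintro ⟨h1, h2⟩
    apply hvN
    refine memN.mpr ⟨hv, fun h => ?_, h2⟩
    rw [Finset.insert_eq_of_mem h] at h1; omega
  have haN : ∀ z w, w ∈ V → w ∉ N → α (insert w (insert z G)) = 0 := by
    intro z w hw hwN
    by_cases hwG : w ∈ G
    · exact alpha_eq_zero hW hG (Or.inr (Or.inl hwG))
    · apply hW.zero
      rintro ⟨-, h2⟩
      exact hwN (memN.mpr ⟨hw, hwG, h2.mono (by
        intro v; simp only [Finset.mem_insert]; tauto)⟩)
  have hNV : N ⊆ V := Finset.filter_subset _ _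
  have hLN : ∀ l : (Fin d → ℝ) → ℝ, (∀ v ∈ G, l v = 0) → ∀ z,
      L V α β (insert z G) l =
      ∑ w ∈ N, α (insert w (insert z G)) * l w - β (insert z G) z * l z := by
    intro l hl z
    rw [L_planar hW hG hl]
    congr 1
    symm
    apply Finset.sum_subset hNV
    intro w hw hwN
    rw [haN z w hw hwN, zero_mul]
  obtain ⟨hD1, hD2⟩ := dirichlet N (fun z w => α (insert w (insert z G)))
    (fun z => β (insert z G) z) f (fun v => g v)
    (fun z w => by rw [Finset.insert_comm])
    (fun z w => by
      by_cases h : (insert w (insert z G)).card = d ∧ Fac V (insert w (insert z G))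
      · exact (hW.pos _ h.1 h.2).le
      · rw [hW.zero _ h])
    (fun z hz => by
      have h1 := L_lin hW (card_insert_lt hG z) g
      rw [hLN _ hgG] at h1
      linarith)
    (fun z hz hgz => by
      rcases hA z hz hgz with h | h
      · rw [h, hfu]
      · exact hfF z h)
    (fun z hz w hw ha hneg => by
      have h1 : (insert w (insert z G)).card = d ∧ Fac V (insert w (insert z G)) := by
        by_contra h; exact ha (hW.zero _ h)
      have hne : z ≠ w := by
        rintro rfl
        have := mul_self_nonneg (g z); linarith
      obtain ⟨h2, h3⟩ := hB z w (memN.mp hz).2.1 (memN.mp hw).2.1 hne h1.2 hneg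
      exact ⟨hfF z h2, hfF w h3⟩)
  have hQN : ∑ v ∈ V, f v * L V α β (insert v G) f = ∑ z ∈ N, f z *
      (∑ w ∈ N, α (insert w (insert z G)) * f w - β (insert z G) z * f z) := by
    rw [← Finset.sum_subset hNV]
    · exact Finset.sum_congr rfl fun z _ => by rw [hLN f hfG]
    · intro v hv hvN; rw [hnotN v hv hvN, mul_zero]
  rw [← hQN] at hD1 hD2
  have hrr := mul_nonneg (sq_nonneg r) hHpos.le
  refine ⟨by linarith, fun heq => ?_⟩
  have hrz : r = 0 := by
    have : r ^ 2 * ∑ v ∈ V, (1 - y v) * L V α β (insert v G) (fun _ => 1) = 0 := by linarith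
    rcases mul_eq_zero.mp this with h | h
    · simpa using h
    · linarith
  have hD3 := hD2 (by rw [hQ, heq, hrz]; ring)
  have hLfk : ∀ v, L V α β (insert v G) k = L V α β (insert v G) f := by
    intro v; rw [hLf v, hrz]; ring
  have hL0 : ∀ v ∈ V, g v ≠ 0 → L V α β (insert v G) k = 0 := by
    intro v hv hgv
    by_cases hvN : v ∈ N
    · rw [hLfk, hLN f hfG]; exact hD3 v hvN hgv
    · exact hnotN v hv hvN k
  have hL1 : ∀ v ∈ V, v ≠ u1 → v ∉ F → L V α β (insert v G) k = 0 := by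
    intro v hv h1 h2
    by_cases hgv : g v = 0
    · by_cases hvN : v ∈ N
      · rcases hA v hvN hgv with h | h
        · exact absurd h h1
        · exact absurd h h2
      · exact hnotN v hv hvN k
    · exact hL0 v hv hgv
  have hLu : L V α β (insert u1 G) k = 0 := by
    rw [Finset.sum_eq_single u1] at hyk
    · rcases mul_eq_zero.mp hyk with h | h
      · linarith
      · exact h
    · intro v hv hvu
      by_cases hvF : v ∈ F
      · rw [hyF v hvF]; ring
      · rw [hL1 v hv hvu hvF, mul_zero]
    · intro h; exact absurd hu1V h
  intro v hv
  by_cases hvF : v ∈ F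
  · by_cases hvG : v ∈ G
    · exact hnotN v hv (fun h => (memN.mp h).2.1 hvG) k
    obtain ⟨t, ht⟩ := exists_functional (hFf.indep hS) (fun w => if w = v then 1 else 0)
    have h1 := closure_lin hS hW hG hGf k t (fun w hw => by
      rw [ht w (hGF hw), if_neg]; rintro rfl; exact hvG hw)
    rw [Finset.sum_eq_single v] at h1
    · rw [ht v hvF, if_pos rfl, one_mul] at h1; exact h1
    · intro w hw hwv
      by_cases hwF : w ∈ F
      · rw [ht w hwF, if_neg hwv, zero_mul]
      · by_cases hwu : w = u1
        · rw [hwu, hLu, mul_zero]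
        · rw [hL1 w hw hwu hwF, mul_zero]
    · intro h; exact absurd hv h
  · by_cases hvu : v = u1
    · rw [hvu, hLu]
    · exact hL1 v hv hvu hvF

end RigAux

namespace RigAux
variable {d : ℕ} {V : Finset (Fin d → ℝ)}
variable {α : Finset (Fin d → ℝ) → ℝ} {β : Finset (Fin d → ℝ) → (Fin d → ℝ) → ℝ}

lemma trace_rank_one (f : (Fin d → ℝ) →ₗ[ℝ] ℝ) (v : Fin d → ℝ) :
    LinearMap.trace ℝ (Fin d → ℝ) (f.smulRight v) = f v := by
  have : f.smulRight v = dualTensorHom ℝ (Fin d → ℝ) (Fin d → ℝ) (f ⊗ₜ[ℝ] v) := by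
    ext x; simp
  rw [this, LinearMap.trace_eq_contract_apply]
  simp

lemma L_congr (hW : Wt V α β) {R : Finset (Fin d → ℝ)} {l l' : (Fin d → ℝ) → ℝ}
    (h1 : ∀ r ∈ R, l r = l' r) (h2 : ∀ w ∈ V, Fac V (insert w R) → l w = l' w) :
    L V α β R l = L V α β R l' := by
  simp only [L]
  congr 1
  · refine Finset.sum_congr rfl fun w hw => ?_
    by_cases h : (insert w R).card = d ∧ Fac V (insert w R)
    · rw [h2 w hw h.2]
    · rw [hW.zero _ h, zero_mul, zero_mul]
  · exact Finset.sum_congr rfl fun r hr => by rw [h1 r hr]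

/-- motion on the star of `v0` -/
def StarMotion (V : Finset (Fin d → ℝ)) (v0 : Fin d → ℝ)
    (m : (Fin d → ℝ) → Fin d → ℝ) : Prop :=
  ∀ u w, Fac V {u, w, v0} → (u - w) ⬝ᵥ (m u - m w) = 0

lemma edge_eq {v0 : Fin d → ℝ} {m : (Fin d → ℝ) → Fin d → ℝ} (hm : StarMotion V v0 m)
    {u w : Fin d → ℝ} (h : Fac V {u, w, v0}) :
    m w ⬝ᵥ w = m u ⬝ᵥ w + m w ⬝ᵥ u - m u ⬝ᵥ u := by
  have := hm u w h
  simp only [dotProduct_sub, sub_dotProduct] at this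
  rw [dotProduct_comm u, dotProduct_comm w, dotProduct_comm u, dotProduct_comm w] at this
  linarith

lemma ridge_eq (hW : Wt V α β) {v0 : Fin d → ℝ} {m : (Fin d → ℝ) → Fin d → ℝ}
    (hm : StarMotion V v0 m) {R : Finset (Fin d → ℝ)} (hR : R.card + 1 = d) (hRf : Fac V R)
    (hv0 : v0 ∈ R) {r : Fin d → ℝ} (hr : r ∈ R) :
    L V α β R (fun w => m w ⬝ᵥ w) =
      L V α β R (fun w => m w ⬝ᵥ r) - (m r ⬝ᵥ r) * L V α β R (fun _ => 1) := by
  have h1 : L V α β R (fun w => m w ⬝ᵥ w) =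
      L V α β R (fun w => (m w ⬝ᵥ r - (m r ⬝ᵥ r) * 1) - (-(dotProductBilin ℝ ℝ (m r))) w) := by
    apply L_congr hW
    · intro w hw
      rw [edge_eq hm (u := r) (w := w) (hRf.mono (by
        intro x; simp only [Finset.mem_insert, Finset.mem_singleton]; rintro (rfl|rfl|rfl) <;> assumption))]
      simp; ring
    · intro w _ hw
      rw [edge_eq hm (u := r) (w := w) (hw.mono (by
        intro x; simp only [Finset.mem_insert, Finset.mem_singleton]; rintro (rfl|rfl|rfl) <;> tauto))]
      simp; ring
  rw [h1, L_sub_lin hW (by omega), L_sub, L_smul]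

lemma motion_balance (hS : Sys V) (hW : Wt V α β) {v0 : Fin d → ℝ}
    {m : (Fin d → ℝ) → Fin d → ℝ} (hm : StarMotion V v0 m) {G : Finset (Fin d → ℝ)}
    (hG : G.card + 2 = d) (hGf : Fac V G) (hv0 : v0 ∈ G) (c : (Fin d → ℝ) →ₗ[ℝ] ℝ)
    (hc : ∀ g ∈ G, c g = 1) :
    ∑ v ∈ V, (1 - c v) * L V α β (insert v G) (fun w => m w ⬝ᵥ w) = 0 := by
  set k : (Fin d → ℝ) → ℝ := fun w => m w ⬝ᵥ w with hk
  obtain ⟨θ, hθ⟩ := exists_functional (hGf.indep hS) k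
  let ψ : (Fin d → ℝ) → ((Fin d → ℝ) →ₗ[ℝ] ℝ) := fun v =>
    { toFun := fun x => L V α β (insert v G) (fun w => m w ⬝ᵥ x - c x * k w - θ x * 1)
      map_add' := by
        intro x y
        rw [← L_add]
        congr 1; funext w
        rw [dotProduct_add, map_add, map_add]; ring
      map_smul' := by
        intro t x
        rw [RingHom.id_apply, smul_eq_mul, ← L_smul]
        congr 1; funext w
        rw [dotProduct_smul, map_smul, map_smul]; simp only [smul_eq_mul]; ring }
  have hψ : ∀ v x, ψ v x = L V α β (insert v G) (fun w => m w ⬝ᵥ x)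
      - c x * L V α β (insert v G) k - θ x * L V α β (insert v G) (fun _ => 1) := by
    intro v x
    show L V α β (insert v G) (fun w => m w ⬝ᵥ x - c x * k w - θ x * 1) = _
    rw [L_sub _ (fun w => m w ⬝ᵥ x - c x * k w), L_sub, L_smul, L_smul]
  set T : (Fin d → ℝ) →ₗ[ℝ] (Fin d → ℝ) := ∑ v ∈ V, (ψ v).smulRight v with hT
  have hψG : ∀ v, ∀ g ∈ G, ψ v g = 0 := by
    intro v g hg
    rw [hψ, hc g hg, hθ g hg]
    by_cases h : (insert v G).card + 1 = d ∧ Fac V (insert v G)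
    · have := ridge_eq hW hm h.1 h.2 (Finset.mem_insert_of_mem hv0) (Finset.mem_insert_of_mem hg)
      simp only [hk]; rw [this]; ring
    · simp [L_zero hW (card_insert_lt hG v) h]
  have hTG : ∀ g ∈ G, T g = 0 := by
    intro g hg
    simp only [hT, LinearMap.sum_apply, LinearMap.smulRight_apply]
    exact Finset.sum_eq_zero fun v _ => by rw [hψG v g hg, zero_smul]
  have hspan : Submodule.span ℝ (G : Set (Fin d → ℝ)) ≤ LinearMap.ker T :=
    Submodule.span_le.mpr fun g hg => hTG g hg
  have hTT : T * T = 0 := by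
    ext1
    apply LinearMap.ext
    intro x
    have h1 : ∀ x, T x ∈ Submodule.span ℝ (G : Set (Fin d → ℝ)) := by
      intro x
      simp only [hT, LinearMap.sum_apply, LinearMap.smulRight_apply]
      exact closure_mem hS hW hG hGf (fun w => m w ⬝ᵥ x - c x * k w - θ x * 1)
    simpa using LinearMap.mem_ker.mp (hspan (h1 _))
  have htr : LinearMap.trace ℝ (Fin d → ℝ) T = 0 := by
    have : IsNilpotent T := ⟨2, by rw [pow_two, hTT]⟩
    exact (LinearMap.isNilpotent_trace_of_isNilpotent this).eq_zero
  rw [hT, map_sum] at htr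
  simp only [trace_rank_one] at htr
  have e1 : ∑ v ∈ V, ψ v v = ∑ v ∈ V, (1 - c v) * L V α β (insert v G) k +
      ∑ v ∈ V, (k v - θ v) * L V α β (insert v G) (fun _ => 1) := by
    rw [← Finset.sum_add_distrib]
    refine Finset.sum_congr rfl fun v _ => ?_
    rw [hψ]
    by_cases h : (insert v G).card + 1 = d ∧ Fac V (insert v G)
    · have := ridge_eq hW hm h.1 h.2 (Finset.mem_insert_of_mem hv0) (Finset.mem_insert_self v G)
      have h2 : L V α β (insert v G) (fun w => m w ⬝ᵥ v) =
        L V α β (insert v G) k + k v * L V α β (insert v G) (fun _ => 1) := by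
        simp only [hk]; rw [this]; ring
      rw [h2]; ring
    · simp [L_zero hW (card_insert_lt hG v) h]
  rw [form_symm' (V := V) hW hG (k := k) (l := fun _ => 1) (θ := θ) (c := c) hθ hc] at e1
  linarith

end RigAux

namespace RigAux
variable {d : ℕ} {V : Finset (Fin d → ℝ)}
variable {α : Finset (Fin d → ℝ) → ℝ} {β : Finset (Fin d → ℝ) → (Fin d → ℝ) → ℝ}

lemma bochner_sum {ι : Type*} (N : Finset ι) (M θ : ι → ι → ℝ) (k h : ι → ℝ)
    (hsymm : ∀ x v, M x v = M v x) (hh : ∀ x ∈ N, 0 ≤ h x)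
    (hbal : ∀ x ∈ N, ∑ v ∈ N, (h v - h x * θ x v) * M x v = 0)
    (hA : ∀ x ∈ N, ∑ v ∈ N, (k v - k x * θ x v) * M x v ≤ 0) :
    ∀ x ∈ N, 0 < h x → ∑ v ∈ N, (k v - k x * θ x v) * M x v = 0 := by
  have e1 : ∑ x ∈ N, h x * ∑ v ∈ N, (k v - k x * θ x v) * M x v =
      ∑ x ∈ N, k x * ∑ v ∈ N, (h v - h x * θ x v) * M x v := by
    have e2 : ∑ x ∈ N, ∑ v ∈ N, h x * k v * M x v = ∑ x ∈ N, ∑ v ∈ N, k x * h v * M x v := by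
      rw [Finset.sum_comm]
      refine Finset.sum_congr rfl fun x _ => Finset.sum_congr rfl fun v _ => ?_
      rw [hsymm]; ring
    have e3 : ∑ x ∈ N, h x * ∑ v ∈ N, (k v - k x * θ x v) * M x v =
        ∑ x ∈ N, ∑ v ∈ N, h x * k v * M x v -
        ∑ x ∈ N, ∑ v ∈ N, h x * k x * θ x v * M x v := by
      simp only [Finset.mul_sum, ← Finset.sum_sub_distrib]
      refine Finset.sum_congr rfl fun x _ => Finset.sum_congr rfl fun v _ => ?_
      ring
    have e4 : ∑ x ∈ N, k x * ∑ v ∈ N, (h v - h x * θ x v) * M x v =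
        ∑ x ∈ N, ∑ v ∈ N, k x * h v * M x v -
        ∑ x ∈ N, ∑ v ∈ N, h x * k x * θ x v * M x v := by
      simp only [Finset.mul_sum, ← Finset.sum_sub_distrib]
      refine Finset.sum_congr rfl fun x _ => Finset.sum_congr rfl fun v _ => ?_
      ring
    rw [e3, e4, e2]
  have e0 : ∑ x ∈ N, h x * ∑ v ∈ N, (k v - k x * θ x v) * M x v = 0 := by
    rw [e1]
    exact Finset.sum_eq_zero fun x hx => by rw [hbal x hx, mul_zero]
  have h1 := (Finset.sum_eq_zero_iff_of_nonpos
    (fun x hx => mul_nonpos_of_nonneg_of_nonpos (hh x hx) (hA x hx))).mp e0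
  intro x hx hpos
  exact (mul_eq_zero.mp (h1 x hx)).resolve_left hpos.ne'

lemma bochner (hd : 4 ≤ d) (hS : Sys V) (hW : Wt V α β) {v0 : Fin d → ℝ}
    {m : (Fin d → ℝ) → Fin d → ℝ} (hm : StarMotion V v0 m) {R : Finset (Fin d → ℝ)}
    (hR : R.card + 1 = d) (hRf : Fac V R) (hv0 : v0 ∈ R) :
    L V α β R (fun w => m w ⬝ᵥ w) = 0 := by
  have hcR : 1 < (R.erase v0).card := by rw [Finset.card_erase_of_mem hv0]; omega
  obtain ⟨u, hu, v, hv, huv⟩ := Finset.one_lt_card.mp hcR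
  rw [Finset.mem_erase] at hu hv
  set B := (R.erase u).erase v with hB
  have huB : u ∉ B := by simp [hB]
  have hvB : v ∉ B := by simp [hB]
  have hvu : v ∈ R.erase u := Finset.mem_erase.mpr ⟨huv.symm, hv.2⟩
  have hRB : insert v (insert u B) = R := by
    rw [Finset.insert_comm, hB, Finset.insert_erase hvu, Finset.insert_erase hu.2]
  have hBR : B ⊆ R := (Finset.erase_subset _ _).trans (Finset.erase_subset _ _)
  have hBc : B.card + 3 = d := by
    have h1 := Finset.card_erase_add_one hvu
    have h2 := Finset.card_erase_add_one hu.2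
    rw [← hB] at h1; omega
  have hBf : Fac V B := hRf.mono hBR
  have hv0B : v0 ∈ B := by
    simp only [hB, Finset.mem_erase]; exact ⟨hv.1.symm, hu.1.symm, hv0⟩
  obtain ⟨y, hy, hyB, hyu⟩ : ∃ y : (Fin d → ℝ) →ₗ[ℝ] ℝ, Valid V y ∧ (∀ b ∈ B, y b = 1) ∧
      y u < 1 := by
    obtain ⟨F, hRF, hcF, hF⟩ := hRf.exists_facet hS
    obtain ⟨hFV, y, hy, hyF⟩ := id hF
    obtain ⟨z, hzf, -, w, hwV, hwF, hzw, s, hs, hval, h1, hfac, hcard⟩ :=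
      facet_pivot' hS hcF hF hy hyF (hRF hu.2)
    refine ⟨y + s • z, hval, ?_, ?_⟩
    · intro b hb
      exact h1 b (Finset.mem_insert_of_mem (Finset.mem_erase.mpr
        ⟨fun h => huB (h ▸ hb), hRF (hBR hb)⟩))
    · simp only [LinearMap.add_apply, LinearMap.smul_apply, smul_eq_mul, hzf, hyF u (hRF hu.2)]
      linarith
  set k0 : (Fin d → ℝ) → ℝ := fun w => m w ⬝ᵥ w with hk0
  obtain ⟨θ0, hθ0⟩ := exists_functional (hBf.indep hS) k0
  set k : (Fin d → ℝ) → ℝ := fun w => k0 w - θ0 w with hk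
  have hkB : ∀ b ∈ B, k b = 0 := fun b hb => by simp [hk, hθ0 b hb]
  have hkL : ∀ R : Finset (Fin d → ℝ), R.card < d → L V α β R k = L V α β R k0 :=
    fun R hR => L_sub_lin hW hR k0 θ0
  have hcc : ∀ x w : Fin d → ℝ, (insert w (insert x B)).card < d := by
    intro x w
    have h1 := Finset.card_insert_le x B
    have h2 := Finset.card_insert_le w (insert x B)
    omega
  have step : ∀ x, ∃ θ : (Fin d → ℝ) →ₗ[ℝ] ℝ, x ∈ V →
      (∑ w ∈ V, ((1 - y w) - (1 - y x) * θ w) * L V α β (insert w (insert x B)) k = 0 ∧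
       ∑ w ∈ V, (k w - k x * θ w) * L V α β (insert w (insert x B)) k ≤ 0 ∧
       (∑ w ∈ V, (k w - k x * θ w) * L V α β (insert w (insert x B)) k = 0 →
        ∀ w ∈ V, L V α β (insert w (insert x B)) k = 0)) := by
    intro x
    by_cases hx : x ∉ B ∧ Fac V (insert x B)
    · obtain ⟨hxB, hxf⟩ := hx
      have hG : (insert x B).card + 2 = d := by rw [Finset.card_insert_of_notMem hxB]; omega
      obtain ⟨θ, hθ⟩ := exists_functional (hxf.indep hS) (fun w => if w = x then 1 else 0)
      have hθx : θ x = 1 := by rw [hθ x (Finset.mem_insert_self _ _)]; simp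
      have hθB : ∀ b ∈ B, θ b = 0 := fun b hb => by
        rw [hθ b (Finset.mem_insert_of_mem hb), if_neg]; rintro rfl; exact hxB hb
      have hc1 : ∀ g ∈ insert x B, (y + (1 - y x) • θ) g = 1 := by
        intro g hg
        rcases Finset.mem_insert.mp hg with rfl | hg
        · simp [hθx]
        · simp [hθB g hg, hyB g hg]
      have hmb := motion_balance hS hW hm hG hxf (Finset.mem_insert_of_mem hv0B) _ hc1
      have hmb' : ∑ w ∈ V, (1 - (y + (1 - y x) • θ) w) *
          L V α β (insert w (insert x B)) k = 0 := by
        rw [← hmb]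
        exact Finset.sum_congr rfl fun w _ => by rw [hkL _ (hcc x w)]
      have hpl := planar hS hW hG hxf k (k x • θ) (y + (1 - y x) • θ) (by
        intro g hg
        rcases Finset.mem_insert.mp hg with rfl | hg
        · simp [hθx]
        · simp [hθB g hg, hkB g hg]) hc1 hmb'
      refine ⟨θ, fun _ => ⟨?_, ?_⟩⟩
      · rw [← hmb']
        exact Finset.sum_congr rfl fun w _ => by
          simp only [LinearMap.add_apply, LinearMap.smul_apply, smul_eq_mul]; ring
      · simpa using hpl
    · have h0 : ∀ w, L V α β (insert w (insert x B)) k = 0 := by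
        intro w
        apply L_zero hW (hcc x w)
        rintro ⟨h1, h2⟩
        apply hx
        refine ⟨fun h => ?_, h2.mono (Finset.subset_insert _ _)⟩
        rw [Finset.insert_eq_of_mem h] at h1
        have := Finset.card_insert_le w B
        omega
      exact ⟨0, fun _ => by simp [h0]⟩
  choose θ hθ using step
  have huV : u ∈ V := hRf.1 hu.2
  have := bochner_sum V (fun x w => L V α β (insert w (insert x B)) k) (fun x w => θ x w) k
    (fun w => 1 - y w) (fun x w => by rw [Finset.insert_comm])
    (fun x hx => by have := hy x hx; linarith) (fun x hx => (hθ x hx).1)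
    (fun x hx => (hθ x hx).2.1) u huV (by linarith)
  have h1 := (hθ u huV).2.2 this v (hRf.1 hv.2)
  rw [hkL _ (hcc u v), hRB] at h1
  exact h1

end RigAux

namespace RigAux
variable {d : ℕ} {V : Finset (Fin d → ℝ)}
variable {α : Finset (Fin d → ℝ) → ℝ} {β : Finset (Fin d → ℝ) → (Fin d → ℝ) → ℝ}

lemma functional_vec (φ : (Fin d → ℝ) →ₗ[ℝ] ℝ) : ∃ b : Fin d → ℝ, ∀ x, φ x = b ⬝ᵥ x := by
  refine ⟨fun i => φ (Pi.single i 1), fun x => ?_⟩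
  rw [LinearMap.pi_apply_eq_sum_univ φ x]
  simp only [dotProduct, smul_eq_mul]
  refine Finset.sum_congr rfl fun i _ => ?_
  rw [mul_comm]
  congr 2
  funext j
  simp [Pi.single_apply, eq_comm]

def Skew (A : (Fin d → ℝ) →ₗ[ℝ] (Fin d → ℝ)) : Prop := ∀ x y, A x ⬝ᵥ y = - (A y ⬝ᵥ x)

lemma clique_lin {F : Finset (Fin d → ℝ)} (hc : F.card = d)
    (hi : LinearIndepOn ℝ id (F : Set (Fin d → ℝ))) (m : (Fin d → ℝ) → Fin d → ℝ)
    (hm : ∀ u ∈ F, ∀ w ∈ F, (u - w) ⬝ᵥ (m u - m w) = 0) :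
    ∃ (A : (Fin d → ℝ) →ₗ[ℝ] (Fin d → ℝ)) (b : Fin d → ℝ), Skew A ∧
      ∀ u ∈ F, m u = A u + b := by
  obtain ⟨φ, hφ⟩ := exists_functional hi (fun u => m u ⬝ᵥ u)
  obtain ⟨b, hb⟩ := functional_vec φ
  have hbF : ∀ u ∈ F, b ⬝ᵥ u = m u ⬝ᵥ u := fun u hu => by rw [← hb, hφ u hu]
  let B := Module.Basis.extend hi
  let A : (Fin d → ℝ) →ₗ[ℝ] (Fin d → ℝ) := B.constr ℝ (fun i => m i - b)
  have hA : ∀ u ∈ F, A u = m u - b := by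
    intro u hu
    have hu' : u ∈ hi.extend (Set.subset_univ _) := hi.subset_extend _ hu
    have h1 : B ⟨u, hu'⟩ = u := Module.Basis.extend_apply_self hi ⟨u, hu'⟩
    have h2 := B.constr_basis ℝ (fun i => m i - b) ⟨u, hu'⟩
    rw [h1] at h2
    exact h2
  have hsk : ∀ u ∈ F, ∀ w ∈ F, A u ⬝ᵥ w + A w ⬝ᵥ u = 0 := by
    intro u hu w hw
    have h1 := hm u hu w hw
    rw [hA u hu, hA w hw]
    simp only [dotProduct_sub, sub_dotProduct] at h1 ⊢
    rw [hbF u hu, hbF w hw]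
    rw [dotProduct_comm u, dotProduct_comm w, dotProduct_comm u, dotProduct_comm w] at h1
    linarith
  refine ⟨A, b, ?_, fun u hu => by rw [hA u hu]; abel⟩
  have h1 : ∀ u ∈ F, ∀ y, A u ⬝ᵥ y + A y ⬝ᵥ u = 0 := by
    intro u hu y
    obtain ⟨c, hcy⟩ := expand hi hc y
    rw [hcy, dotProduct_sum, map_sum, sum_dotProduct, ← Finset.sum_add_distrib]
    refine Finset.sum_eq_zero fun w hw => ?_
    rw [dotProduct_smul, map_smul, smul_dotProduct, ← smul_add, hsk u hu w hw, smul_zero]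
  intro x y
  have : A x ⬝ᵥ y + A y ⬝ᵥ x = 0 := by
    obtain ⟨c, hcx⟩ := expand hi hc x
    rw [hcx, dotProduct_sum, map_sum, sum_dotProduct, ← Finset.sum_add_distrib]
    refine Finset.sum_eq_zero fun w hw => ?_
    rw [dotProduct_smul, map_smul, smul_dotProduct, ← smul_add, h1 w hw, smul_zero]
  linarith

lemma skew_self {A : (Fin d → ℝ) →ₗ[ℝ] (Fin d → ℝ)} (hA : Skew A) (x : Fin d → ℝ) :
    A x ⬝ᵥ x = 0 := by have := hA x x; linarith

lemma propagate (hd : 4 ≤ d) (hS : Sys V) {v0 : Fin d → ℝ} {m : (Fin d → ℝ) → Fin d → ℝ}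
    (hm : StarMotion V v0 m) {F : Finset (Fin d → ℝ)} (hcF : F.card = d) (hF : Fac V F)
    (hv0 : v0 ∈ F) {A : (Fin d → ℝ) →ₗ[ℝ] (Fin d → ℝ)} {b : Fin d → ℝ} (hA : Skew A)
    (hmF : ∀ u ∈ F, m u = A u + b) {f w : Fin d → ℝ} (hf : f ∈ F) (hfv : f ≠ v0)
    (hwF : w ∉ F) (hW' : Fac V (insert w (F.erase f))) : m w = A w + b := by
  obtain ⟨α, β, hW⟩ := exists_wt hS
  set R := F.erase f with hR
  have hRc : R.card + 1 = d := by rw [hR, Finset.card_erase_add_one hf, hcF]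
  have hfR : f ∉ R := by simp [hR]
  have hFR : insert f R = F := Finset.insert_erase hf
  have hwR : w ∉ R := fun h => hwF (Finset.mem_of_mem_erase h)
  have hv0R : v0 ∈ R := Finset.mem_erase.mpr ⟨hfv.symm, hv0⟩
  have hfw : f ≠ w := fun h => hwF (h ▸ hf)
  have hwc : (insert w R).card = d := by rw [Finset.card_insert_of_notMem hwR, hRc]
  have hwV : w ∈ V := hW'.1 (Finset.mem_insert_self _ _)
  have hkF : ∀ u ∈ F, m u ⬝ᵥ u - b ⬝ᵥ u = 0 := by
    intro u hu
    rw [hmF u hu, add_dotProduct, skew_self hA]; ring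
  have hL := bochner hd hS hW hm hRc (hF.mono (Finset.erase_subset _ _)) hv0R
  rw [← L_sub_lin hW (by omega) _ (dotProductBilin ℝ ℝ b), L,
    Finset.sum_eq_zero (s := R), sub_zero, Finset.sum_eq_single w] at hL
  · have hkw : m w ⬝ᵥ w = b ⬝ᵥ w := by
      rcases mul_eq_zero.mp hL with h | h
      · exact absurd h (hW.pos _ hwc hW').ne'
      · simp at h; linarith
    set n := m w - A w - b with hn
    have hnw : n ⬝ᵥ w = 0 := by
      rw [hn, sub_dotProduct, sub_dotProduct, skew_self hA, hkw]; ring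
    have hnr : ∀ r ∈ R, n ⬝ᵥ r = 0 := by
      intro r hr
      have h1 := edge_eq hm (u := r) (w := w) (hW'.mono (by
        intro x; simp only [Finset.mem_insert, Finset.mem_singleton]
        rintro (rfl|rfl|rfl) <;> tauto))
      have h2 := hkF r (Finset.mem_of_mem_erase hr)
      have h3 := hA r w
      rw [hn, sub_dotProduct, sub_dotProduct]
      have h4 : m r ⬝ᵥ w = A r ⬝ᵥ w + b ⬝ᵥ w := by
        rw [hmF r (Finset.mem_of_mem_erase hr), add_dotProduct]
      linarith
    have hn0 : dotProductBilin ℝ ℝ n = 0 := by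
      apply functional_ext (hW'.indep hS) hwc
      intro v hv
      rcases Finset.mem_insert.mp hv with rfl | hv
      · simpa using hnw
      · simpa using hnr v hv
    have hnn : n ⬝ᵥ n = 0 := by
      have := LinearMap.congr_fun hn0 n
      simpa using this
    have : n = 0 := dotProduct_self_eq_zero.mp hnn
    rw [hn] at this
    have h5 : m w - A w - b + (A w + b) = A w + b := by rw [this, zero_add]
    rw [← h5]; abel
  · intro x hx hxw
    by_cases hxa : (insert x R).card = d ∧ Fac V (insert x R)
    · have hxR : x ∉ R := by
        intro h; rw [Finset.insert_eq_of_mem h] at hxa; omega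
      rcases ridge_two hS hRc hfR hwR hxR hfw (hFR ▸ hF) hW' hxa.2 with h | h
      · rw [h]
        have := hkF f hf
        simp [this]
      · exact absurd h hxw
    · rw [hW.zero _ hxa, zero_mul]
  · intro h; exact absurd hwV h
  · intro r hr
    have := hkF r (Finset.mem_of_mem_erase hr)
    simp [this]

theorem star_rigid (hd : 4 ≤ d) (hS : Sys V) {v0 : Fin d → ℝ} {m : (Fin d → ℝ) → Fin d → ℝ}
    (hm : StarMotion V v0 m) :
    ∃ (A : (Fin d → ℝ) →ₗ[ℝ] (Fin d → ℝ)) (b : Fin d → ℝ), Skew A ∧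
      ∀ u, Fac V {u, v0} → m u = A u + b := by
  by_cases h0 : Fac V {v0}
  swap
  · refine ⟨0, 0, fun x y => by simp, fun u hu => absurd (hu.mono (by simp)) h0⟩
  obtain ⟨F0, hF0s, hcF0, hF0⟩ := h0.exists_facet hS
  have hv0F0 : v0 ∈ F0 := hF0s (Finset.mem_singleton_self _)
  obtain ⟨A, b, hA, hmF0⟩ := clique_lin hcF0 (hF0.indep hS) m (fun u hu w hw =>
    hm u w (hF0.mono (by
      intro x; simp only [Finset.mem_insert, Finset.mem_singleton]
      rintro (rfl|rfl|rfl) <;> assumption)))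
  refine ⟨A, b, hA, fun u hu => ?_⟩
  obtain ⟨G, hGs, hcG, hG⟩ := hu.exists_facet hS
  have hv0G : v0 ∈ G := hGs (by simp)
  have huG : u ∈ G := hGs (by simp)
  let Fs := V.powerset.filter fun F =>
    v0 ∈ F ∧ F.card = d ∧ Fac V F ∧ ∀ u ∈ F, m u = A u + b
  let Y : Finset (Fin d → ℝ) → ((Fin d → ℝ) →ₗ[ℝ] ℝ) := fun F =>
    if h : Fac V F then h.2.choose else 0
  have hY : ∀ F, Fac V F → Valid V (Y F) ∧ ∀ v ∈ F, Y F v = 1 := by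
    intro F h
    simp only [Y, dif_pos h]
    exact h.2.choose_spec
  have hne : Fs.Nonempty :=
    ⟨F0, by simp only [Fs, Finset.mem_filter, Finset.mem_powerset]
            exact ⟨hF0.1, hv0F0, hcF0, hF0, hmF0⟩⟩
  set c : Fin d → ℝ := ∑ g ∈ G, g with hc
  obtain ⟨F, hF, hmax⟩ := Finset.exists_max_image Fs (fun F => Y F c) hne
  simp only [Fs, Finset.mem_filter, Finset.mem_powerset] at hF hmax
  obtain ⟨hFV, hv0F, hcF, hFf, hmF⟩ := hF
  obtain ⟨lam, hlam⟩ := expand (hFf.indep hS) hcF c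
  have hpos : ∀ f ∈ F.erase v0, 0 ≤ lam f := by
    intro f hf
    rw [Finset.mem_erase] at hf
    by_contra hneg
    rw [not_le] at hneg
    obtain ⟨z, hzf, hzR, w, hwV, hwF, hzw, s, hs, hval, h1, hfac, hcard⟩ :=
      facet_pivot' hS hcF hFf (hY F hFf).1 (hY F hFf).2 hf.2
    have h2 : Y (insert w (F.erase f)) = Y F + s • z := by
      apply functional_ext (hfac.indep hS) hcard
      intro v hv
      rw [(hY _ hfac).2 v hv, h1 v hv]
    have h3 := hmax (insert w (F.erase f)) ⟨hfac.1,
      Finset.mem_insert_of_mem (Finset.mem_erase.mpr ⟨hf.1.symm, hv0F⟩), hcard, hfac, ?_⟩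
    · rw [h2] at h3
      simp only [LinearMap.add_apply, LinearMap.smul_apply, smul_eq_mul] at h3
      have h5 : z c = - lam f := by
        rw [hlam, map_sum, Finset.sum_eq_single f]
        · simp [hzf]
        · intro v hv hvf
          rw [map_smul, hzR v (Finset.mem_erase.mpr ⟨hvf, hv⟩), smul_zero]
        · intro h; exact absurd hf.2 h
      rw [h5] at h3
      nlinarith
    · intro v hv
      rcases Finset.mem_insert.mp hv with rfl | hv
      · exact propagate hd hS hm hcF hFf hv0F hA hmF hf.2 hf.1 hwF hfac
      · exact hmF v (Finset.mem_of_mem_erase hv)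
  have hsub : G.erase v0 ⊆ F.erase v0 := by
    apply carrier_mod hS (G := {v0}) (by simp) (by simp)
      (by rw [Finset.union_comm, ← Finset.insert_eq, Finset.insert_erase hv0G]; exact hG)
      (by rw [Finset.union_comm, ← Finset.insert_eq, Finset.insert_erase hv0F]; exact hFf)
      (fun _ => 1) lam (by simp) hpos
    have e1 : c = v0 + ∑ g ∈ G.erase v0, g := by rw [hc, Finset.add_sum_erase _ (fun g => g) hv0G]
    have e2 : c = lam v0 • v0 + ∑ g ∈ F.erase v0, lam g • g := by
      rw [hlam, Finset.add_sum_erase _ (fun g => lam g • g) hv0F]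
    have e3 : ∑ v ∈ G.erase v0, (1:ℝ) • v - ∑ v ∈ F.erase v0, lam v • v =
        (lam v0 - 1) • v0 := by
      simp only [one_smul]
      have h6 : ∑ g ∈ G.erase v0, g = c - v0 := by rw [e1]; abel
      have h7 : ∑ g ∈ F.erase v0, lam g • g = c - lam v0 • v0 := by
        rw [eq_sub_iff_add_eq, add_comm]; exact e2.symm
      rw [h6, h7, sub_smul, one_smul]; abel
    rw [e3]
    exact Submodule.smul_mem _ _ (Submodule.subset_span (by simp))
  apply hmF
  by_cases huv : u = v0
  · rw [huv]; exact hv0F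
  · exact Finset.mem_of_mem_erase (hsub (Finset.mem_erase.mpr ⟨huv, huG⟩))

end RigAux

namespace RigAux
variable {d : ℕ} {V : Finset (Fin d → ℝ)}

lemma valid_body {y : (Fin d → ℝ) →ₗ[ℝ] ℝ} {c : ℝ} (hy : ∀ v ∈ V, y v ≤ c) :
    ∀ x ∈ polyBody V, y x ≤ c := by
  intro x hx
  have h1 : convexHull ℝ (V : Set (Fin d → ℝ)) ⊆ {x | y x ≤ c} :=
    convexHull_min (fun v hv => hy v hv) (convex_halfSpace_le y.isLinear c)
  exact h1 hx

lemma zero_mem_body (P : SPolytope d) (hcs : IsCS P) : (0 : Fin d → ℝ) ∈ polyBody P.V := by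
  have hne : (P.V : Set (Fin d → ℝ)).Nonempty := by
    rw [← affineSpan_nonempty ℝ, P.span_top]
    exact ⟨0, trivial⟩
  obtain ⟨v, hv⟩ := hne
  have h1 : v ∈ polyBody P.V := subset_convexHull ℝ _ hv
  have h2 : -v ∈ polyBody P.V := subset_convexHull ℝ _ (hcs v hv)
  have h3 := (convex_convexHull ℝ (P.V : Set (Fin d → ℝ))) h1 h2
    (a := 1/2) (b := 1/2) (by norm_num) (by norm_num) (by norm_num)
  unfold polyBody
  simpa using h3

lemma proper_of_valid (P : SPolytope d) (hcs : IsCS P) {y : (Fin d → ℝ) →ₗ[ℝ] ℝ}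
    (hy : Valid P.V y) : IsProperFace P.V {x ∈ polyBody P.V | y x = 1} := by
  refine ⟨⟨y, 1, valid_body hy, rfl⟩, fun h => ?_⟩
  have h0 := zero_mem_body P hcs
  rw [← h] at h0
  have := h0.2
  simp at this

lemma sys_of_polytope (P : SPolytope d) (hcs : IsCS P) : Sys P.V where
  neg := hcs
  span := by
    intro z hz
    have h1 : affineSpan ℝ (P.V : Set (Fin d → ℝ)) ≤ (LinearMap.ker z).toAffineSubspace := by
      rw [affineSpan_le]
      intro v hv
      exact hz v hv
    rw [P.span_top] at h1
    apply LinearMap.ext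
    intro x
    have : x ∈ (LinearMap.ker z).toAffineSubspace := h1 trivial
    exact this
  indep := by
    intro y hy
    obtain ⟨h1, -⟩ := P.simplicial _ (proper_of_valid P hcs hy)
    have h2 : ∀ v ∈ P.V.filter (fun v => y v = 1),
        v ∈ (P.V : Set (Fin d → ℝ)) ∩ {x ∈ polyBody P.V | y x = 1} := by
      intro v hv
      rw [Finset.mem_filter] at hv
      exact ⟨hv.1, subset_convexHull ℝ _ hv.1, hv.2⟩
    rw [affineIndependent_iff] at h1
    show LinearIndependent ℝ _
    have h3 : LinearIndependent ℝ (fun x : {w : Fin d → ℝ //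
        w ∈ (P.V : Set (Fin d → ℝ)) ∩ {x ∈ polyBody P.V | y x = 1}} => (x : Fin d → ℝ)) := by
      rw [linearIndependent_iff']
      intro s g hg
      refine h1 s g ?_ hg
      have := congrArg y hg
      rw [map_sum, map_zero] at this
      rw [← this]
      refine Finset.sum_congr rfl fun x _ => ?_
      rw [map_smul, x.2.2.2, smul_eq_mul, mul_one]
    exact h3.comp (fun x : ((P.V.filter fun v => y v = 1 : Finset (Fin d → ℝ)) :
      Set (Fin d → ℝ)) => ⟨x.1, h2 x.1 x.2⟩) (fun a b hab => by
        simp only [Subtype.mk.injEq] at hab; exact Subtype.ext hab)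

lemma bface_iff (P : SPolytope d) (hcs : IsCS P) (s : Finset (Fin d → ℝ)) :
    BFace P s ↔ Fac P.V s := by
  constructor
  · rintro ⟨hs, F, ⟨⟨f, c, hle, hF⟩, hne⟩, hsF⟩
    refine ⟨hs, ?_⟩
    have hV : ∀ v ∈ P.V, f v ≤ c := fun v hv => hle v (subset_convexHull ℝ _ hv)
    have hc0 : 0 ≤ c := by
      have := hle 0 (zero_mem_body P hcs)
      simpa using this
    have hc : 0 < c := by
      rcases lt_or_eq_of_le hc0 with h | h
      · exact h
      · exfalso
        apply hne
        have hz : f = 0 := by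
          apply (sys_of_polytope P hcs).span
          intro v hv
          have h1 := hV v hv
          have h2 := hV (-v) (hcs v hv)
          rw [map_neg] at h2
          linarith
        rw [hF, hz, ← h]
        ext x; simp
    refine ⟨c⁻¹ • f, fun v hv => ?_, fun v hv => ?_⟩
    · have := hV v hv
      simp only [LinearMap.smul_apply, smul_eq_mul]
      rw [inv_mul_le_iff₀ hc]; linarith
    · have h1 := hsF hv
      rw [hF] at h1
      simp only [LinearMap.smul_apply, smul_eq_mul]
      rw [h1.2]; field_simp
  · rintro ⟨hs, y, hy, hys⟩
    exact ⟨hs, _, proper_of_valid P hcs hy,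
      fun v hv => ⟨subset_convexHull ℝ _ (hs hv), hys v hv⟩⟩

lemma clique_affine {F : Finset (Fin d → ℝ)} (hc : F.card = d)
    (hi : AffineIndependent ℝ (fun s : {x : Fin d → ℝ // x ∈ F} => (s : Fin d → ℝ)))
    (m : (Fin d → ℝ) → Fin d → ℝ)
    (hm : ∀ u ∈ F, ∀ w ∈ F, (u - w) ⬝ᵥ (m u - m w) = 0) :
    ∃ (A : (Fin d → ℝ) →ₗ[ℝ] (Fin d → ℝ)) (b : Fin d → ℝ), Skew A ∧
      ∀ u ∈ F, m u = A u + b := by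
  set p : {x : Fin d → ℝ // x ∈ F} → (Fin d → ℝ) := fun s => (s : Fin d → ℝ) with hp
  have hne : affineSpan ℝ (Set.range p) ≠ ⊤ := by
    intro h
    rw [hi.affineSpan_eq_top_iff_card_eq_finrank_add_one] at h
    simp [hc] at h
  obtain ⟨q, hq⟩ : ∃ q, q ∉ affineSpan ℝ (Set.range p) := by
    by_contra hcon
    push Not at hcon
    exact hne (by ext x; simp [hcon x])
  have hlin : LinearIndependent ℝ (fun s => p s - q) := by
    rw [linearIndependent_iff']
    intro t g hg
    have h1 : ∑ i ∈ t, g i • p i = (∑ i ∈ t, g i) • q := by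
      rw [Finset.sum_smul, ← sub_eq_zero, ← Finset.sum_sub_distrib, ← hg]
      exact Finset.sum_congr rfl fun i _ => by rw [smul_sub]
    by_cases hW : ∑ i ∈ t, g i = 0
    · rw [hW, zero_smul] at h1
      exact (affineIndependent_iff.mp hi) t g hW h1
    · exfalso
      apply hq
      have h2 : ∑ i ∈ t, (∑ i ∈ t, g i)⁻¹ * g i = 1 := by
        rw [← Finset.mul_sum]; field_simp
      have h3 := affineCombination_mem_affineSpan h2 p
      rw [Finset.affineCombination_eq_linear_combination _ _ _ h2] at h3
      have h4 : ∑ i ∈ t, ((∑ i ∈ t, g i)⁻¹ * g i) • p i = q := by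
        simp only [← smul_smul]
        rw [← Finset.smul_sum, h1, smul_smul, inv_mul_cancel₀ hW, one_smul]
      rwa [h4] at h3
  have himg : LinearIndepOn ℝ id ((F.image fun x => x - q : Finset _) : Set (Fin d → ℝ)) := by
    have h1 := hlin.linearIndepOn_id
    have h2 : Set.range (fun s => p s - q) =
        ((F.image fun x => x - q : Finset _) : Set (Fin d → ℝ)) := by
      ext x; simp [hp]
    rwa [h2] at h1
  obtain ⟨A, b, hA, h1⟩ := clique_lin (F := F.image fun x => x - q)
    (by rw [Finset.card_image_of_injective _ (sub_left_injective), hc]) himg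
    (fun x => m (x + q)) (by
      intro u hu w hw
      rw [Finset.mem_image] at hu hw
      obtain ⟨u, hu, rfl⟩ := hu
      obtain ⟨w, hw, rfl⟩ := hw
      simpa using hm u hu w hw)
  refine ⟨A, b - A q, hA, fun u hu => ?_⟩
  have h2 := h1 (u - q) (Finset.mem_image_of_mem _ hu)
  simp only [sub_add_cancel, map_sub] at h2
  rw [h2]; abel

lemma skew_matrix {A : (Fin d → ℝ) →ₗ[ℝ] (Fin d → ℝ)} (hA : Skew A) :
    (LinearMap.toMatrix' A).transpose = - LinearMap.toMatrix' A := by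
  ext i j
  simp only [Matrix.transpose_apply, Matrix.neg_apply, LinearMap.toMatrix'_apply]
  have := hA (Pi.single i 1) (Pi.single j 1)
  simpa [Pi.single_apply] using this

theorem cone_rigid (hd : 4 ≤ d) (P : SPolytope d) (hcs : IsCS P)
    (hgen : GenPos P) (v0 : Fin d → ℝ) (hv0 : v0 ∈ P.V)
    (τ : Finset (Fin d → ℝ)) (hτcard : τ.card = d - 1)
    (hτsub : ∀ ρ ⊂ τ, LinkFace P {v0} ρ)
    (S1 S2 : Set (Finset (Fin d → ℝ)))
    (hdc1 : ∀ s ∈ S1, ∀ t ⊆ s, t ∈ S1) (hdc2 : ∀ s ∈ S2, ∀ t ⊆ s, t ∈ S2)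
    (hv1 : ∀ s ∈ S1, ∀ u ∈ s, LinkFace P {v0} {u})
    (hunion : S1 ∪ S2 = {σ : Finset (Fin d → ℝ) | LinkFace P {v0} σ} ∪ {τ})
    (hinter : S1 ∩ S2 = {σ : Finset (Fin d → ℝ) | σ ⊆ τ}) :
    IsInfRigid d (coneGraph P v0 S1) (fun x => x) := by
  intro m hm
  have hS := sys_of_polytope P hcs
  -- basic facts on `τ`
  have hv0τ : v0 ∉ τ := by
    intro h
    have h1 := (hτsub {v0} ?_).1
    · simp at h1
    · refine Finset.ssubset_iff_subset_ne.mpr ⟨by simpa using h, fun he => ?_⟩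
      rw [← he] at hτcard; simp at hτcard; omega
  have pairτ : ∀ x ∈ insert v0 τ, ∀ y ∈ insert v0 τ, Fac P.V {x, y, v0} := by
    intro x hx y hy
    have hsub : ({x, y} : Finset (Fin d → ℝ)).erase v0 ⊆ τ := by
      intro z hz
      rw [Finset.mem_erase, Finset.mem_insert, Finset.mem_singleton] at hz
      rcases hz.2 with rfl | rfl
      · exact (Finset.mem_insert.mp hx).resolve_left hz.1
      · exact (Finset.mem_insert.mp hy).resolve_left hz.1
    have hss : ({x, y} : Finset (Fin d → ℝ)).erase v0 ⊂ τ := by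
      refine Finset.ssubset_iff_subset_ne.mpr ⟨hsub, fun he => ?_⟩
      have h1 := Finset.card_le_card (Finset.erase_subset v0 ({x, y} : Finset (Fin d → ℝ)))
      have h2 := Finset.card_le_two (a := x) (b := y)
      rw [he] at h1
      omega
    have h1 := (bface_iff P hcs _).mp (hτsub _ hss).2
    refine h1.mono ?_
    intro z
    simp only [Finset.mem_insert, Finset.mem_singleton, Finset.mem_union, Finset.mem_erase]
    tauto
  have hS1V : ∀ u, {u} ∈ S1 → Fac P.V {u, v0} := by
    intro u hu
    have := (bface_iff P hcs _).mp (hv1 _ hu u (Finset.mem_singleton_self u)).2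
    exact this
  have hKS1 : ∀ s ⊆ τ, s ∈ S1 ∧ s ∈ S2 := by
    intro s hs
    have : s ∈ S1 ∩ S2 := by rw [hinter]; exact hs
    exact this
  -- edges of the cone
  have hE : ∀ x y, x ∈ P.V → y ∈ P.V → ({x, y} : Finset (Fin d → ℝ)).erase v0 ∈ S1 →
      (x - y) ⬝ᵥ (m x - m y) = 0 := by
    intro x y hx hy hρ
    by_cases hxy : x = y
    · subst hxy; simp
    have hspoke : ∀ z ∈ P.V, {z} ∈ S1 → ∀ a ∈ ({v0, z} : Finset (Fin d → ℝ)),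
        ∀ b ∈ ({v0, z} : Finset (Fin d → ℝ)), (a - b) ⬝ᵥ (m a - m b) = 0 := by
      intro z hz hzS a ha b hb
      refine hm {v0, z} ?_ a ha b hb
      simp only [coneGraph]
      apply Finset.mem_union_right
      rw [Finset.mem_image]
      exact ⟨z, by simp [hz, hzS], rfl⟩
    by_cases hx0 : x = v0
    · have h1 : {y} ∈ S1 := hdc1 _ hρ {y} (by
        intro z; simp only [Finset.mem_singleton]; rintro rfl
        simp only [Finset.mem_erase, Finset.mem_insert, Finset.mem_singleton]
        exact ⟨fun h => hxy (hx0.trans h.symm), by simp⟩)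
      exact hspoke y hy h1 x (by simp [hx0]) y (by simp)
    by_cases hy0 : y = v0
    · have h1 : {x} ∈ S1 := hdc1 _ hρ {x} (by
        intro z; simp only [Finset.mem_singleton]; rintro rfl
        simp only [Finset.mem_erase, Finset.mem_insert, Finset.mem_singleton]
        exact ⟨hx0, by simp⟩)
      exact hspoke x hx h1 x (by simp) y (by simp [hy0])
    rw [Finset.erase_eq_of_notMem (by simp [Ne.symm hx0, Ne.symm hy0])] at hρ
    refine hm {x, y} ?_ x (by simp) y (by simp)
    simp only [coneGraph]
    apply Finset.mem_union_left
    rw [Finset.mem_filter, Finset.mem_powerset]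
    refine ⟨?_, Finset.card_pair hxy, hρ⟩
    intro z hz
    rw [Finset.mem_insert, Finset.mem_singleton] at hz
    rcases hz with rfl | rfl <;> assumption
  have hKV : insert v0 τ ⊆ P.V := fun x hx => (pairτ x hx x hx).1 (by simp)
  have hKc : (insert v0 τ).card = d := by rw [Finset.card_insert_of_notMem hv0τ]; omega
  have hKi := hgen (insert v0 τ) hKV hKc (by
    intro x hx y hy hxy
    obtain ⟨-, f, -, hf⟩ := pairτ x hx y hy
    have h1 := hf x (by simp)
    have h2 := hf y (by simp)
    rw [hxy, map_neg, h2] at h1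
    norm_num at h1)
  obtain ⟨A, b, hA, hAb⟩ := clique_affine hKc hKi m (by
    intro x hx y hy
    apply hE x y (hKV hx) (hKV hy)
    apply (hKS1 _ _).1
    intro z hz
    rw [Finset.mem_erase, Finset.mem_insert, Finset.mem_singleton] at hz
    rcases hz.2 with rfl | rfl
    · exact (Finset.mem_insert.mp hx).resolve_left hz.1
    · exact (Finset.mem_insert.mp hy).resolve_left hz.1)
  set n : (Fin d → ℝ) → (Fin d → ℝ) := fun u =>
    if {u} ∈ S1 ∨ u = v0 then m u - A u - b else 0 with hn
  have hnK : ∀ u ∈ insert v0 τ, n u = 0 := by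
    intro u hu
    simp only [hn]
    split_ifs
    · rw [hAb u hu]; abel
    · rfl
  have hstar : StarMotion P.V v0 n := by
    intro u w hf
    set ρ := ({u, w} : Finset (Fin d → ℝ)).erase v0 with hρ
    have hlk : LinkFace P {v0} ρ := by
      refine ⟨by simp [hρ], (bface_iff P hcs _).mpr (hf.mono ?_)⟩
      intro z
      simp only [hρ, Finset.mem_insert, Finset.mem_singleton, Finset.mem_union, Finset.mem_erase]
      tauto
    have hmem : ρ ∈ S1 ∪ S2 := by rw [hunion]; exact Or.inl hlk
    have hin : ∀ x ∈ ({u, w} : Finset (Fin d → ℝ)), x = v0 ∨ {x} ⊆ ρ := by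
      intro x hx
      by_cases h : x = v0
      · exact Or.inl h
      · right
        rw [Finset.singleton_subset_iff, hρ, Finset.mem_erase]
        exact ⟨h, hx⟩
    rcases hmem with h1 | h2
    · have hval : ∀ x ∈ ({u, w} : Finset (Fin d → ℝ)), n x = m x - A x - b := by
        intro x hx
        simp only [hn]
        rw [if_pos]
        rcases hin x hx with h | h
        · exact Or.inr h
        · exact Or.inl (hdc1 _ h1 _ h)
      rw [hval u (by simp), hval w (by simp)]
      have h3 := hE u w (hf.1 (by simp)) (hf.1 (by simp)) h1
      have h4 : m u - A u - b - (m w - A w - b) = (m u - m w) - A (u - w) := by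
        rw [map_sub]; abel
      rw [h4, dotProduct_sub, h3, dotProduct_comm, skew_self hA, sub_zero]
    · have hval : ∀ x ∈ ({u, w} : Finset (Fin d → ℝ)), n x = 0 := by
        intro x hx
        rcases hin x hx with h | h
        · exact hnK x (by simp [h])
        · by_cases hx1 : {x} ∈ S1
          · have : ({x} : Finset (Fin d → ℝ)) ∈ S1 ∩ S2 := ⟨hx1, hdc2 _ h2 _ h⟩
            rw [hinter] at this
            exact hnK x (Finset.mem_insert_of_mem (Finset.singleton_subset_iff.mp this))
          · by_cases hx0 : x = v0
            · exact hnK x (by simp [hx0])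
            · simp only [hn]
              rw [if_neg]
              rintro (h | h)
              · exact hx1 h
              · exact hx0 h
      rw [hval u (by simp), hval w (by simp)]; simp
  obtain ⟨A', b', hA', hstarA⟩ := star_rigid hd hS hstar
  have hAA : Skew (A + A') := by
    intro x y
    simp only [LinearMap.add_apply, add_dotProduct]
    rw [hA x y, hA' x y]; ring
  refine ⟨LinearMap.toMatrix' (A + A'), b + b', skew_matrix hAA, ?_⟩
  intro u hu
  rw [LinearMap.toMatrix'_mulVec]
  simp only [coneGraph, Finset.mem_insert, Finset.mem_filter] at hu
  have hnu : n u = m u - A u - b := by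
    simp only [hn]
    rw [if_pos]
    tauto
  have hfu : Fac P.V {u, v0} := by
    rcases hu with h | h
    · have h1 := pairτ v0 (by simp) v0 (by simp)
      rw [h]; exact h1.mono (by simp)
    · exact hS1V u h.2
  have h5 := hstarA u hfu
  rw [hnu] at h5
  have h6 : m u = (m u - A u - b) + (A u + b) := by abel
  rw [h6, h5, LinearMap.add_apply]; abel

end RigAux

/-- Let `d ≥ 4`, let `P` be a prime cs simplicial `d`-polytope in general
position (every `d` vertices, no two antipodal, affinely independent), let `v₀` be a
vertex, `τ` a missing facet of `lk(v₀)`, and `S₁, S₂` simplicial complexes on subsets of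
`V(lk(v₀))` with `S₁ ∪ S₂ = lk(v₀) ∪ {τ}`, `S₁ ∩ S₂ = ` the full simplex on `τ`, each
`S_i` having a vertex outside `τ`. Then the cone frameworks `(v₀ * S₁, p)` and
`(v₀ * S₂, p)` are infinitesimally rigid in `ℝ^d`. -/
theorem stmt14 {d : ℕ} (hd : 4 ≤ d) (P : SPolytope d) (hp : IsPrimePoly P) (hcs : IsCS P)
    (hgen : GenPos P) (v0 : Fin d → ℝ) (hv0 : v0 ∈ P.V)
    (τ : Finset (Fin d → ℝ)) (hτcard : τ.card = d - 1)
    (hτnot : ¬ LinkFace P {v0} τ) (hτsub : ∀ ρ ⊂ τ, LinkFace P {v0} ρ)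
    (S1 S2 : Set (Finset (Fin d → ℝ)))
    (hdc1 : ∀ s ∈ S1, ∀ t ⊆ s, t ∈ S1) (hdc2 : ∀ s ∈ S2, ∀ t ⊆ s, t ∈ S2)
    (hv1 : ∀ s ∈ S1, ∀ u ∈ s, LinkFace P {v0} {u})
    (hv2 : ∀ s ∈ S2, ∀ u ∈ s, LinkFace P {v0} {u})
    (hunion : S1 ∪ S2 = {σ : Finset (Fin d → ℝ) | LinkFace P {v0} σ} ∪ {τ})
    (hinter : S1 ∩ S2 = {σ : Finset (Fin d → ℝ) | σ ⊆ τ})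
    (hx1 : ∃ x, ({x} : Finset (Fin d → ℝ)) ∈ S1 ∧ x ∉ τ)
    (hx2 : ∃ x, ({x} : Finset (Fin d → ℝ)) ∈ S2 ∧ x ∉ τ) :
    IsInfRigid d (coneGraph P v0 S1) (fun x => x) ∧
    IsInfRigid d (coneGraph P v0 S2) (fun x => x) := by
  refine ⟨RigAux.cone_rigid hd P hcs hgen v0 hv0 τ hτcard hτsub S1 S2 hdc1 hdc2 hv1
    hunion hinter, ?_⟩
  exact RigAux.cone_rigid hd P hcs hgen v0 hv0 τ hτcard hτsub S2 S1 hdc2 hdc1 hv2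
    (by rw [Set.union_comm]; exact hunion) (by rw [Set.inter_comm]; exact hinter)
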